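/- arXiv:1108.4637 — 5 statements merged into one kernel-verified Lean document; each statement's English description precedes it below -/
import Mathlib

section
/- Let 𝔉 be a closed subset of ℂ and let f : 𝔉 → ℂ be continuous. The following are equivalent (all operators range over all complex Hilbert spaces): (i) ‖f(N₁) − f(N₂)‖ ≤ ‖N₁ − N₂‖ for all bounded normal operators N₁, N₂ with spectra contained in 𝔉; (ii) ‖f(N)U − Uf(N)‖ ≤ ‖NU − UN‖ for all bounded normal N with spectrum in 𝔉 and all unitary operators U; (iii) ‖f(N)A − Af(N)‖ ≤ ‖NA − AN‖ for all such N and all bounded self-adjoint operators A; (iv) ‖f(N)Q − Qf(N)‖ ≤ ‖NQ − QN‖ for all such N and all self-adjoint unitary operators Q; (v) ‖f(N)P − Pf(N)‖ ≤ ‖NP − PN‖ for all such N and all orthogonal projections P; (vi) ‖f(N)R − Rf(N)‖ ≤ max{‖NR − RN‖, ‖N*R − RN*‖} for all such N and all bounded operators R; (vii) ‖f(N₁)R − Rf(N₂)‖ ≤ max{‖N₁R − RN₂‖, ‖N₁*R − RN₂*‖} for all bounded normal N₁, N₂ with spectra in 𝔉 and all bounded operators R. -/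
/-- The operator on the Hilbert sum `H ⊕ H` with block matrix `!![a, b; c, d]`. -/
noncomputable def blockOperator {H : Type*} [NormedAddCommGroup H] [InnerProductSpace ℂ H]
    (a b c d : H →L[ℂ] H) : WithLp 2 (H × H) →L[ℂ] WithLp 2 (H × H) :=
  (WithLp.prodContinuousLinearEquiv 2 ℂ H H).symm.toContinuousLinearMap ∘L
    ((a ∘L WithLp.fstL 2 ℂ H H + b ∘L WithLp.sndL 2 ℂ H H).prod
      (c ∘L WithLp.fstL 2 ℂ H H + d ∘L WithLp.sndL 2 ℂ H H))

section blockOperator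

variable {H : Type*} [NormedAddCommGroup H] [InnerProductSpace ℂ H]

lemma blockOperator_apply (a b c d : H →L[ℂ] H) (x : WithLp 2 (H × H)) :
    blockOperator a b c d x = WithLp.toLp 2 (a x.fst + b x.snd, c x.fst + d x.snd) :=
  rfl

lemma blockOperator_one : blockOperator (1 : H →L[ℂ] H) 0 0 1 = 1 := by
  refine ContinuousLinearMap.ext fun x ↦ WithLp.ofLp_injective 2 (Prod.ext ?_ ?_) <;>
    simp [blockOperator_apply]

lemma blockOperator_mul (a b c d a' b' c' d' : H →L[ℂ] H) :
    blockOperator a b c d * blockOperator a' b' c' d' =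
      blockOperator (a * a' + b * c') (a * b' + b * d') (c * a' + d * c') (c * b' + d * d') := by
  refine ContinuousLinearMap.ext fun x ↦ WithLp.ofLp_injective 2 (Prod.ext ?_ ?_) <;>
    simp [blockOperator_apply] <;> abel

lemma blockOperator_add (a b c d a' b' c' d' : H →L[ℂ] H) :
    blockOperator a b c d + blockOperator a' b' c' d' =
      blockOperator (a + a') (b + b') (c + c') (d + d') := by
  refine ContinuousLinearMap.ext fun x ↦ WithLp.ofLp_injective 2 (Prod.ext ?_ ?_) <;>
    simp [blockOperator_apply] <;> abel

lemma blockOperator_sub (a b c d a' b' c' d' : H →L[ℂ] H) :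
    blockOperator a b c d - blockOperator a' b' c' d' =
      blockOperator (a - a') (b - b') (c - c') (d - d') := by
  refine ContinuousLinearMap.ext fun x ↦ WithLp.ofLp_injective 2 (Prod.ext ?_ ?_) <;>
    simp [blockOperator_apply] <;> abel

lemma blockOperator_smul (r : ℂ) (a b c d : H →L[ℂ] H) :
    r • blockOperator a b c d = blockOperator (r • a) (r • b) (r • c) (r • d) := by
  refine ContinuousLinearMap.ext fun x ↦ WithLp.ofLp_injective 2 (Prod.ext ?_ ?_) <;>
    simp [blockOperator_apply]

lemma star_blockOperator [CompleteSpace H] (a b c d : H →L[ℂ] H) :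
    star (blockOperator a b c d) = blockOperator (star a) (star c) (star b) (star d) := by
  rw [ContinuousLinearMap.star_eq_adjoint, eq_comm, ContinuousLinearMap.eq_adjoint_iff]
  intro x y
  simp [blockOperator_apply, WithLp.prod_inner_apply, ContinuousLinearMap.star_eq_adjoint,
    ContinuousLinearMap.adjoint_inner_left, inner_add_left, inner_add_right]
  ring

lemma norm_blockOperator_antidiag (s t : H →L[ℂ] H) :
    ‖blockOperator 0 s t 0‖ = max ‖s‖ ‖t‖ := by
  apply le_antisymm
  · refine ContinuousLinearMap.opNorm_le_bound _ (by positivity) fun x ↦ ?_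
    refine le_of_sq_le_sq ?_ (by positivity)
    have hs : ‖s x.snd‖ ≤ max ‖s‖ ‖t‖ * ‖x.snd‖ :=
      s.le_of_opNorm_le (le_max_left _ _) _
    have ht : ‖t x.fst‖ ≤ max ‖s‖ ‖t‖ * ‖x.fst‖ :=
      t.le_of_opNorm_le (le_max_right _ _) _
    have hs2 := pow_le_pow_left₀ (norm_nonneg _) hs 2
    have ht2 := pow_le_pow_left₀ (norm_nonneg _) ht 2
    rw [mul_pow, WithLp.prod_norm_sq_eq_of_L2, WithLp.prod_norm_sq_eq_of_L2]
    simp only [blockOperator_apply, zero_apply, zero_add, add_zero]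
    refine (add_le_add hs2 ht2).trans_eq ?_
    ring
  · refine max_le ?_ ?_ <;>
      refine ContinuousLinearMap.opNorm_le_bound _ (norm_nonneg (blockOperator 0 s t 0)) fun y ↦ ?_
    · simpa [blockOperator_apply] using
        (blockOperator 0 s t 0).le_opNorm (WithLp.toLp 2 ((0 : H), y))
    · simpa [blockOperator_apply] using
        (blockOperator 0 s t 0).le_opNorm (WithLp.toLp 2 (y, (0 : H)))

lemma blockOperator_diag_commutator (a d s t : H →L[ℂ] H) :
    blockOperator a 0 0 d * blockOperator 0 s t 0 - blockOperator 0 s t 0 * blockOperator a 0 0 d =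
      blockOperator 0 (a * s - s * d) (d * t - t * a) 0 := by
  simp [blockOperator_mul, blockOperator_sub]

variable (H) in
/-- The block diagonal embedding as a star algebra homomorphism. -/
noncomputable def blockDiagonalHom [CompleteSpace H] :
    (H →L[ℂ] H) × (H →L[ℂ] H) →⋆ₐ[ℂ] (WithLp 2 (H × H) →L[ℂ] WithLp 2 (H × H)) where
  toFun p := blockOperator p.1 0 0 p.2
  map_one' := blockOperator_one
  map_mul' p q := by simp [blockOperator_mul]
  map_zero' := by simpa using (blockOperator_sub (0 : H →L[ℂ] H) 0 0 0 0 0 0 0).symm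
  map_add' p q := by simp [blockOperator_add]
  commutes' r := by
    simp only [Algebra.algebraMap_eq_smul_one, Prod.smul_fst, Prod.smul_snd, Prod.fst_one,
      Prod.snd_one]
    simpa [blockOperator_one] using (blockOperator_smul r (1 : H →L[ℂ] H) 0 0 1).symm
  map_star' p := by simp [star_blockOperator]

variable [CompleteSpace H] {N₁ N₂ : H →L[ℂ] H}

lemma isStarNormal_blockOperator_diag (h₁ : IsStarNormal N₁) (h₂ : IsStarNormal N₂) :
    IsStarNormal (blockOperator N₁ 0 0 N₂) where
  star_comm_self := by
    have e₁ := h₁.star_comm_self.eq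
    have e₂ := h₂.star_comm_self.eq
    simp [commute_iff_eq, star_blockOperator, blockOperator_mul, e₁, e₂]

lemma spectrum_blockOperator_diag_subset (N₁ N₂ : H →L[ℂ] H) :
    spectrum ℂ (blockOperator N₁ 0 0 N₂) ⊆ spectrum ℂ N₁ ∪ spectrum ℂ N₂ := by
  rw [← Prod.spectrum_eq]
  exact AlgHom.spectrum_apply_subset (blockDiagonalHom H) (N₁, N₂)

lemma cfc_blockOperator_diag {f : ℂ → ℂ} (h₁ : IsStarNormal N₁) (h₂ : IsStarNormal N₂)
    (hf : ContinuousOn f (spectrum ℂ N₁ ∪ spectrum ℂ N₂)) :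
    cfc f (blockOperator N₁ 0 0 N₂) = blockOperator (cfc f N₁) 0 0 (cfc f N₂) := by
  have h : IsStarNormal (N₁, N₂) := ⟨Prod.ext h₁.star_comm_self h₂.star_comm_self⟩
  have hmap := StarAlgHomClass.map_cfc (S := ℂ) (blockDiagonalHom H) f (N₁, N₂)
    (by rwa [Prod.spectrum_eq]) (map_continuous _) h (isStarNormal_blockOperator_diag h₁ h₂)
  rw [cfc_map_prod (S := ℂ) f N₁ N₂ hf h h₁ h₂] at hmap
  exact hmap.symm

end blockOperator

lemma IsSelfAdjoint.norm_star_commutator {A : Type*} [NormedRing A] [StarRing A]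
    [NormedStarGroup A] {b : A} (hb : IsSelfAdjoint b) (a : A) :
    ‖star a * b - b * star a‖ = ‖a * b - b * a‖ := by
  rw [← norm_star (a * b - b * a), ← norm_neg]
  simp [hb.star_eq]

lemma norm_commutator_unitary {A : Type*} [NormedRing A] [StarRing A] [CStarRing A] {u : A}
    (hu : u ∈ unitary A) (a : A) : ‖a * u - u * a‖ = ‖a - u * a * star u‖ := by
  rw [← CStarRing.norm_mul_mem_unitary (a - u * a * star u) hu, sub_mul, mul_assoc _ (star u),
    Unitary.star_mul_self_of_mem hu, mul_one]

lemma cfc_unitary_conj {A : Type*} [CStarAlgebra A] {f : ℂ → ℂ} {a u : A} (ha : IsStarNormal a)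
    (hu : u ∈ unitary A) (hf : ContinuousOn f (spectrum ℂ a)) :
    cfc f (u * a * star u) = u * cfc f a * star u := by
  let φ := Unitary.conjStarAlgAut ℂ A ⟨u, hu⟩
  have hφ : Continuous φ := by
    change Continuous fun x ↦ u * x * star u
    fun_prop
  exact (StarAlgHomClass.map_cfc (S := ℂ) φ f a hf hφ ha (ha.map φ)).symm

/-- If the commutators of `b` and of `a` with every unitary compare in norm, then so do the
commutators with every self-adjoint element. -/
lemma norm_commutator_le_of_unitary {A : Type*} [CStarAlgebra A] {a b x : A}
    (h : ∀ u ∈ unitary A, ‖b * u - u * b‖ ≤ ‖a * u - u * a‖) (hx : IsSelfAdjoint x) :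
    ‖b * x - x * b‖ ≤ ‖a * x - x * a‖ := by
  let u : ℝ → A := fun t ↦ NormedSpace.exp (t • (Complex.I • x))
  have hu : ∀ t, u t ∈ unitary A := fun t ↦ by
    have hu' := (selfAdjoint.expUnitary (⟨t • x, (IsSelfAdjoint.all t).smul hx⟩ : selfAdjoint A)).2
    rwa [selfAdjoint.expUnitary_coe, smul_comm] at hu'
  have hu0 : u 0 = 1 := by simp [u]
  have hderiv : HasDerivAt u (Complex.I • x) 0 := by
    simpa using hasDerivAt_exp_smul_const (𝕂 := ℝ) (Complex.I • x) 0
  have hlim (c : A) : Filter.Tendsto (fun t : ℝ ↦ ‖t⁻¹ • (c * u t - u t * c)‖)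
      (nhdsWithin 0 {0}ᶜ) (nhds ‖c * x - x * c‖) := by
    have hc := ((hderiv.const_mul c).sub (hderiv.mul_const c)).tendsto_slope_zero.norm
    simpa [hu0, ← smul_sub, norm_smul] using hc
  refine le_of_tendsto_of_tendsto' (hlim b) (hlim a) fun t ↦ ?_
  rw [norm_smul, norm_smul]
  gcongr
  exact h _ (hu t)

lemma norm_commutator_two_smul_sub_one {A : Type*} [NormedRing A] [NormedAlgebra ℂ A] (a p : A) :
    ‖a * ((2 : ℂ) • p - 1) - ((2 : ℂ) • p - 1) * a‖ = 2 * ‖a * p - p * a‖ := by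
  rw [mul_sub, sub_mul, mul_one, one_mul, sub_sub_sub_cancel_right, mul_smul_comm, smul_mul_assoc,
    ← smul_sub, norm_smul]
  norm_num


/-- Theorem 3.1 (Theorem `sr`): for a continuous function `f` on a closed subset `F` of `ℂ`,
seven contractivity properties involving normal operators with spectra in `F` are equivalent. -/
theorem stmt_0 (F : Set ℂ) (hF : IsClosed F) (f : ℂ → ℂ) (hf : ContinuousOn f F) :
    List.TFAE
      [ -- (i)
        (∀ (H : Type) [NormedAddCommGroup H] [InnerProductSpace ℂ H] [CompleteSpace H]
          (N₁ N₂ : H →L[ℂ] H), IsStarNormal N₁ → IsStarNormal N₂ →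
          spectrum ℂ N₁ ⊆ F → spectrum ℂ N₂ ⊆ F →
          ‖cfc f N₁ - cfc f N₂‖ ≤ ‖N₁ - N₂‖),
        -- (ii)
        (∀ (H : Type) [NormedAddCommGroup H] [InnerProductSpace ℂ H] [CompleteSpace H]
          (N U : H →L[ℂ] H), IsStarNormal N → spectrum ℂ N ⊆ F →
          U ∈ unitary (H →L[ℂ] H) →
          ‖cfc f N * U - U * cfc f N‖ ≤ ‖N * U - U * N‖),
        -- (iii)
        (∀ (H : Type) [NormedAddCommGroup H] [InnerProductSpace ℂ H] [CompleteSpace H]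
          (N A : H →L[ℂ] H), IsStarNormal N → spectrum ℂ N ⊆ F →
          IsSelfAdjoint A →
          ‖cfc f N * A - A * cfc f N‖ ≤ ‖N * A - A * N‖),
        -- (iv)
        (∀ (H : Type) [NormedAddCommGroup H] [InnerProductSpace ℂ H] [CompleteSpace H]
          (N Q : H →L[ℂ] H), IsStarNormal N → spectrum ℂ N ⊆ F →
          Q ∈ unitary (H →L[ℂ] H) → IsSelfAdjoint Q →
          ‖cfc f N * Q - Q * cfc f N‖ ≤ ‖N * Q - Q * N‖),
        -- (v)
        (∀ (H : Type) [NormedAddCommGroup H] [InnerProductSpace ℂ H] [CompleteSpace H]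
          (N P : H →L[ℂ] H), IsStarNormal N → spectrum ℂ N ⊆ F →
          IsSelfAdjoint P → P * P = P →
          ‖cfc f N * P - P * cfc f N‖ ≤ ‖N * P - P * N‖),
        -- (vi)
        (∀ (H : Type) [NormedAddCommGroup H] [InnerProductSpace ℂ H] [CompleteSpace H]
          (N R : H →L[ℂ] H), IsStarNormal N → spectrum ℂ N ⊆ F →
          ‖cfc f N * R - R * cfc f N‖ ≤
            max ‖N * R - R * N‖ ‖star N * R - R * star N‖),
        -- (vii)
        (∀ (H : Type) [NormedAddCommGroup H] [InnerProductSpace ℂ H] [CompleteSpace H]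
          (N₁ N₂ R : H →L[ℂ] H), IsStarNormal N₁ → IsStarNormal N₂ →
          spectrum ℂ N₁ ⊆ F → spectrum ℂ N₂ ⊆ F →
          ‖cfc f N₁ * R - R * cfc f N₂‖ ≤
            max ‖N₁ * R - R * N₂‖ ‖star N₁ * R - R * star N₂‖) ] := by
  tfae_have 1 → 2 := by
    intro h H _ _ _ N U hN hσ hU
    rw [norm_commutator_unitary hU, norm_commutator_unitary hU,
      ← cfc_unitary_conj hN hU (hf.mono hσ)]
    have hconj : spectrum ℂ (U * N * star U) = spectrum ℂ N :=
      AlgEquiv.spectrum_eq (Unitary.conjStarAlgAut ℂ (H →L[ℂ] H) ⟨U, hU⟩) N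
    exact h H N _ hN (hN.map (Unitary.conjStarAlgAut ℂ (H →L[ℂ] H) ⟨U, hU⟩)) hσ (hconj ▸ hσ)
  tfae_have 2 → 3 := by
    intro h H _ _ _ N A hN hσ hA
    exact norm_commutator_le_of_unitary (fun U hU ↦ h H N U hN hσ hU) hA
  tfae_have 3 → 7 := by
    intro h H _ _ _ N₁ N₂ R h₁ h₂ hσ₁ hσ₂
    have hA : IsSelfAdjoint (blockOperator 0 R (star R) 0) := by
      simp [isSelfAdjoint_iff, star_blockOperator]
    have key := h _ (blockOperator N₁ 0 0 N₂) _ (isStarNormal_blockOperator_diag h₁ h₂)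
      ((spectrum_blockOperator_diag_subset N₁ N₂).trans (Set.union_subset hσ₁ hσ₂)) hA
    rw [cfc_blockOperator_diag h₁ h₂ (hf.mono (Set.union_subset hσ₁ hσ₂)),
      blockOperator_diag_commutator, blockOperator_diag_commutator, norm_blockOperator_antidiag,
      norm_blockOperator_antidiag] at key
    have hstar : ‖N₂ * star R - star R * N₁‖ = ‖star N₁ * R - R * star N₂‖ := by
      rw [← norm_star, ← norm_neg]
      simp
    exact (le_max_left _ _).trans (hstar ▸ key)
  tfae_have 7 → 6 := fun h H _ _ _ N R hN hσ ↦ h H N N R hN hN hσ hσ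
  tfae_have 6 → 3 := by
    intro h H _ _ _ N A hN hσ hA
    simpa [hA.norm_star_commutator] using h H N A hN hσ
  tfae_have 3 → 4 := fun h H _ _ _ N Q hN hσ _ hQ ↦ h H N Q hN hσ hQ
  tfae_have 4 → 5 := by
    intro h H _ _ _ N P hN hσ hP hPP
    have hQ : IsSelfAdjoint ((2 : ℂ) • P - 1) := by
      simp [isSelfAdjoint_iff, hP.star_eq]
    have hQQ : ((2 : ℂ) • P - 1) * ((2 : ℂ) • P - 1) = 1 := by
      simp only [mul_sub, sub_mul, smul_mul_smul_comm, hPP, mul_one, one_mul]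
      module
    have key := h H N _ hN hσ
      (Unitary.mem_iff.mpr ⟨by rw [hQ.star_eq, hQQ], by rw [hQ.star_eq, hQQ]⟩) hQ
    simpa [norm_commutator_two_smul_sub_one] using key
  tfae_have 5 → 4 := by
    intro h H _ _ _ N Q hN hσ hQu hQ
    have hQQ : Q * Q = 1 := by
      simpa [hQ.star_eq] using Unitary.star_mul_self_of_mem hQu
    obtain ⟨P, rfl⟩ : ∃ P : H →L[ℂ] H, Q = (2 : ℂ) • P - 1 := ⟨(2⁻¹ : ℂ) • (Q + 1), by simp⟩
    have hP : IsSelfAdjoint P := by simpa [isSelfAdjoint_iff] using hQ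
    have hPP : P * P = P := by
      simp only [mul_sub, sub_mul, smul_mul_smul_comm, mul_one, one_mul] at hQQ
      have h4 : (4 : ℂ) • (P * P - P) = 0 := by
        rw [← sub_eq_zero] at hQQ
        rw [← hQQ]
        module
      simpa [sub_eq_zero] using h4
    simpa [norm_commutator_two_smul_sub_one] using h H N P hN hσ hP hPP
  tfae_have 4 → 1 := by
    intro h H _ _ _ N₁ N₂ h₁ h₂ hσ₁ hσ₂
    have hQ : IsSelfAdjoint (blockOperator (0 : H →L[ℂ] H) 1 1 0) := by
      simp [isSelfAdjoint_iff, star_blockOperator]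
    have hQQ : blockOperator (0 : H →L[ℂ] H) 1 1 0 * blockOperator 0 1 1 0 = 1 := by
      simp [blockOperator_mul, blockOperator_one]
    have key := h _ (blockOperator N₁ 0 0 N₂) _ (isStarNormal_blockOperator_diag h₁ h₂)
      ((spectrum_blockOperator_diag_subset N₁ N₂).trans (Set.union_subset hσ₁ hσ₂))
      (Unitary.mem_iff.mpr ⟨by rw [hQ.star_eq, hQQ], by rw [hQ.star_eq, hQQ]⟩) hQ
    rw [cfc_blockOperator_diag h₁ h₂ (hf.mono (Set.union_subset hσ₁ hσ₂)),
      blockOperator_diag_commutator, blockOperator_diag_commutator, norm_blockOperator_antidiag,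
      norm_blockOperator_antidiag] at key
    simpa [norm_sub_rev (cfc f N₂), norm_sub_rev N₂] using key
  tfae_finish
end

section
/- Let f : ℂ → ℂ be a continuous function that is operator Lipschitz on ℂ, i.e., there is a constant C such that ‖f(N₁) − f(N₂)‖ ≤ C‖N₁ − N₂‖ for all bounded normal operators N₁, N₂ on every complex Hilbert space. Then f has a finite derivative at every point of ℂ in every direction: for every ζ ∈ ℂ and every ξ ∈ ℂ, the limit of (f(ζ + tξ) − f(ζ))/t as the real parameter t tends to 0 (t ≠ 0) exists in ℂ. -/
open Filter Topology Matrix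
open scoped Matrix.Norms.L2Operator

/-- The functional calculus of `f` is Lipschitz with constant `C` on the normal operators of every
complex Hilbert space. -/
def OperatorLipschitz (f : ℂ → ℂ) (C : ℝ) : Prop :=
  ∀ (H : Type) [NormedAddCommGroup H] [InnerProductSpace ℂ H] [CompleteSpace H]
    (N₁ N₂ : H →L[ℂ] H), IsStarNormal N₁ → IsStarNormal N₂ →
    ‖cfc f N₁ - cfc f N₂‖ ≤ C * ‖N₁ - N₂‖

theorem norm_deriv_le_of_norm_le {E : Type*} [NormedAddCommGroup E] [NormedSpace ℝ E]
    {u v : ℝ → E} {u' v' : E} {C : ℝ} (hu : HasDerivAt u u' 0) (hv : HasDerivAt v v' 0)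
    (hu₀ : u 0 = 0) (hv₀ : v 0 = 0) (h : ∀ s, ‖u s‖ ≤ C * ‖v s‖) : ‖u'‖ ≤ C * ‖v'‖ := by
  rw [hasDerivAt_iff_tendsto_slope_zero] at hu hv
  simp only [zero_add, hu₀, hv₀, sub_zero] at hu hv
  refine le_of_tendsto_of_tendsto' hu.norm (hv.norm.const_mul C) fun s ↦ ?_
  rw [norm_smul, norm_smul, mul_left_comm]
  exact mul_le_mul_of_nonneg_left (h s) (norm_nonneg _)

namespace OperatorLipschitz

variable {f : ℂ → ℂ} {C : ℝ}

theorem norm_commutator_unitary_le {H : Type} [NormedAddCommGroup H] [InnerProductSpace ℂ H]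
    [CompleteSpace H] (h : OperatorLipschitz f C) (hf : Continuous f) {N : H →L[ℂ] H}
    (hN : IsStarNormal N) (U : unitary (H →L[ℂ] H)) :
    ‖cfc f N * U - U * cfc f N‖ ≤ C * ‖N * U - U * N‖ := by
  have key (A : H →L[ℂ] H) : ‖A * U - U * A‖ = ‖A - U * A * star (U : H →L[ℂ] H)‖ := by
    rw [← CStarRing.norm_mul_coe_unitary (A - U * A * star (U : H →L[ℂ] H)) U, sub_mul,
      mul_assoc _ (star _), Unitary.coe_star_mul_self, mul_one]
  have hN' : IsStarNormal (Unitary.conjStarAlgAut ℂ _ U N) := hN.map _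
  have hmap : Unitary.conjStarAlgAut ℂ _ U (cfc f N) = cfc f (Unitary.conjStarAlgAut ℂ _ U N) := by
    refine StarAlgHomClass.map_cfc (S := ℂ) _ f N hf.continuousOn ?_
    change Continuous fun x : H →L[ℂ] H ↦ (U : H →L[ℂ] H) * x * star (U : H →L[ℂ] H)
    fun_prop
  rw [key, key]
  have hle := h H N _ hN hN'
  rwa [← hmap] at hle

theorem norm_commutator_skewAdjoint_le {H : Type} [NormedAddCommGroup H] [InnerProductSpace ℂ H]
    [CompleteSpace H] (h : OperatorLipschitz f C) (hf : Continuous f) {N : H →L[ℂ] H}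
    (hN : IsStarNormal N) {K : H →L[ℂ] H} (hK : K ∈ skewAdjoint (H →L[ℂ] H)) :
    ‖cfc f N * K - K * cfc f N‖ ≤ C * ‖N * K - K * N‖ := by
  have hexp : HasDerivAt (fun s : ℝ ↦ NormedSpace.exp (s • K)) K 0 := by
    simpa using hasDerivAt_exp_smul_const (𝕂 := ℝ) K 0
  have hderiv (A : H →L[ℂ] H) : HasDerivAt
      (fun s : ℝ ↦ A * NormedSpace.exp (s • K) - NormedSpace.exp (s • K) * A) (A * K - K * A) 0 :=
    (hexp.const_mul A).sub (hexp.mul_const A)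
  let _ : NormedAlgebra ℚ (H →L[ℂ] H) := .restrictScalars ℚ ℂ _
  refine norm_deriv_le_of_norm_le (hderiv _) (hderiv _) (by simp) (by simp) fun s ↦ ?_
  exact h.norm_commutator_unitary_le hf hN
    ⟨_, NormedSpace.exp_mem_unitary_of_mem_skewAdjoint (skewAdjoint.smul_mem s hK)⟩

theorem norm_sub_le (h : OperatorLipschitz f C) (z w : ℂ) : ‖f z - f w‖ ≤ C * ‖z - w‖ := by
  have hnormal (z : ℂ) : IsStarNormal (algebraMap ℂ (ℂ →L[ℂ] ℂ) z) :=
    ⟨Algebra.commute_algebraMap_right _ _⟩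
  simpa [cfc_algebraMap, ← map_sub, norm_algebraMap'] using
    h ℂ (algebraMap ℂ _ z) (algebraMap ℂ _ w) (hnormal z) (hnormal w)

theorem norm_diagonal_commutator_le (h : OperatorLipschitz f C) (hf : Continuous f) {ι : Type}
    [Fintype ι] [DecidableEq ι] (d : ι → ℂ) {K : Matrix ι ι ℂ} (hK : Kᴴ = -K) :
    ‖diagonal (f ∘ d) * K - K * diagonal (f ∘ d)‖ ≤ C * ‖diagonal d * K - K * diagonal d‖ := by
  let φ : (ι → ℂ) →⋆ₐ[ℂ] (EuclideanSpace ℂ ι →L[ℂ] EuclideanSpace ℂ ι) :=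
    { toFun v := toEuclideanCLM (n := ι) (𝕜 := ℂ) (diagonal v)
      map_one' := by simp
      map_mul' v w := by rw [← map_mul, diagonal_mul_diagonal]; rfl
      map_zero' := by simp
      map_add' v w := by rw [← map_add, diagonal_add]; rfl
      commutes' r := by
        rw [← AlgHomClass.commutes (toEuclideanCLM (n := ι) (𝕜 := ℂ)) r]; rfl
      map_star' v := by rw [← map_star, star_eq_conjTranspose, diagonal_conjTranspose] }
  have hφ : Continuous φ := φ.toAlgHom.toLinearMap.continuous_of_finiteDimensional
  have hd : IsStarNormal d := inferInstance
  have hmap : cfc f (φ d) = φ (f ∘ d) := by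
    rw [← φ.map_cfc f d hf.continuousOn hφ hd (hd.map φ), cfc_map_pi (S := ℂ) f d hf.continuousOn]
    congr 1
    ext i
    simpa using cfc_algebraMap (A := ℂ) (d i) f
  have := h.norm_commutator_skewAdjoint_le hf (hd.map φ)
    (K := toEuclideanCLM (n := ι) (𝕜 := ℂ) K) (by
      rw [skewAdjoint.mem_iff, ← map_star, star_eq_conjTranspose, hK, map_neg])
  rw [hmap] at this
  simpa only [φ, StarAlgHom.coe_mk, AlgHom.coe_mk, ← map_mul, ← map_sub, cstar_norm_def] using this

theorem norm_dividedDifference_mul_le (h : OperatorLipschitz f C) (hf : Continuous f) {ι : Type}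
    [Fintype ι] [DecidableEq ι] (ζ ξ : ℂ) {t : ι → ℝ} (ht : t.Injective) {Y : Matrix ι ι ℂ}
    (hY : Y.IsHermitian) (hdiag : ∀ i, Y i i = 0) :
    ‖(of fun i j ↦ (f (ζ + t i * ξ) - f (ζ + t j * ξ)) / (t i - t j) * Y i j : Matrix ι ι ℂ)‖ ≤
      C * (‖ξ‖ * ‖Y‖) := by
  let K : Matrix ι ι ℂ := of fun i j ↦ Y i j / (t i - t j)
  have hK : Kᴴ = -K := by
    ext i j
    have : star (Y j i) = Y i j := hY.apply i j
    simp only [K, conjTranspose_apply, of_apply, Matrix.neg_apply, star_div₀, this]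
    rw [← div_neg]
    simp
  have hle := h.norm_diagonal_commutator_le hf (fun i ↦ ζ + t i * ξ) hK
  rw [← norm_smul]
  convert hle using 2
  · ext i j
    simp only [K, of_apply, Matrix.sub_apply, diagonal_mul, mul_diagonal, Function.comp_apply]
    ring
  · congr 1
    ext i j
    simp only [K, of_apply, Matrix.sub_apply, diagonal_mul, mul_diagonal, Matrix.smul_apply,
      smul_eq_mul]
    rcases eq_or_ne i j with rfl | hij
    · simp [hdiag]
    · have : (t i - t j : ℂ) ≠ 0 := by
        rw [sub_ne_zero]
        exact_mod_cast ht.ne hij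
      field_simp
      ring

end OperatorLipschitz

theorem norm_sum_upperRight_le {ι : Type*} [Fintype ι] [DecidableEq ι]
    (M : Matrix (ι ⊕ ι) (ι ⊕ ι) ℂ) :
    ‖∑ i, ∑ j, M (.inl i) (.inr j)‖ ≤ ‖M‖ * Fintype.card ι := by
  let u : EuclideanSpace ℂ (ι ⊕ ι) := WithLp.toLp 2 (Sum.elim 1 0)
  let v : EuclideanSpace ℂ (ι ⊕ ι) := WithLp.toLp 2 (Sum.elim 0 1)
  have hu : ‖u‖ = √(Fintype.card ι) := by simp [u, EuclideanSpace.norm_eq]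
  have hv : ‖v‖ = √(Fintype.card ι) := by simp [v, EuclideanSpace.norm_eq]
  have hsum : ∑ i, ∑ j, M (.inl i) (.inr j) =
      inner ℂ u (toEuclideanCLM (n := ι ⊕ ι) (𝕜 := ℂ) M v) := by
    simp [u, v, PiLp.inner_apply, mulVec, dotProduct]
  rw [hsum]
  calc _ ≤ ‖u‖ * (‖toEuclideanCLM (n := ι ⊕ ι) (𝕜 := ℂ) M‖ * ‖v‖) :=
        (norm_inner_le_norm _ _).trans
          (mul_le_mul_of_nonneg_left (ContinuousLinearMap.le_opNorm _ _) (norm_nonneg _))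
    _ = ‖M‖ * Fintype.card ι := by
        rw [l2_opNorm_toEuclideanCLM, hu, hv, mul_left_comm,
          Real.mul_self_sqrt (Nat.cast_nonneg _)]

/-- A multiple of a unitary matrix, of norm `√(n + 1)`, whose triangular truncation has norm at
least `(n + 1) / 2`. The matrix `R` anticommuting with it serves the inductive construction. -/
theorem exists_large_triangular_truncation (n : ℕ) :
    ∃ (ι : Type) (_ : Fintype ι) (_ : DecidableEq ι) (r : ι → ℕ) (B : ℕ) (W R : Matrix ι ι ℂ),
      r.Injective ∧ (∀ i, r i < B) ∧ Wᴴ = -W ∧ W * W = -((n + 1 : ℂ) • 1) ∧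
      R * W + W * R = 0 ∧ R * R = 1 ∧ Rᴴ = R ∧ ∑ i, ∑ j, R i j = Fintype.card ι ∧
      0 < Fintype.card ι ∧ ∀ (a b : ℂ) (m : ι → ι → ℂ),
        (∀ i j, r i ≤ r j → m i j = a) → (∀ i j, r j < r i → m i j = b) →
        ∑ i, ∑ j, m i j * W i j = (a - b) * ((n + 1) / 2 * Fintype.card ι) := by
  induction n with
  | zero =>
    refine ⟨Fin 2, inferInstance, inferInstance, Fin.val, 2, !![0, 1; -1, 0], !![0, 1; 1, 0],
      Fin.val_injective, Fin.isLt, ?_, ?_, ?_, ?_, ?_, ?_, by simp, fun a b m hma hmb ↦ ?_⟩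
    · ext i j; fin_cases i <;> fin_cases j <;> simp
    · ext i j; fin_cases i <;> fin_cases j <;> simp
    · ext i j; fin_cases i <;> fin_cases j <;> simp
    · ext i j; fin_cases i <;> fin_cases j <;> simp
    · ext i j; fin_cases i <;> fin_cases j <;> simp
    · simp [Fin.sum_univ_two]; norm_num
    · simp [Fin.sum_univ_two, hma 0 1, hmb 1 0]; ring
  | succ n ih =>
    obtain ⟨ι, _, _, r, B, W, R, hr, hB, hW, hWW, hRW, hRR, hR, hsum, hcard, htri⟩ := ih
    refine ⟨ι ⊕ ι, inferInstance, inferInstance, Sum.elim r (fun i ↦ B + r i), B + B,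
      fromBlocks W R (-R) W, fromBlocks 0 R R 0, ?_, ?_, ?_, ?_, ?_, ?_, ?_, ?_, ?_, fun a b m hma hmb ↦ ?_⟩
    · refine hr.sumElim (fun i j hij ↦ hr (Nat.add_left_cancel hij)) fun i j ↦ ?_
      have := hB i
      omega
    · rintro (i | i) <;> have := hB i <;> simp <;> omega
    · simp [fromBlocks_conjTranspose, hW, hR, fromBlocks_neg]
    · have hWR : W * R + R * W = 0 := by rw [add_comm, hRW]
      rw [← fromBlocks_one, fromBlocks_smul, fromBlocks_neg, fromBlocks_multiply]
      congr 1
      · rw [hWW, mul_neg, hRR, ← neg_add]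
        congr 1
        push_cast
        module
      · simpa using hWR
      · rw [neg_mul, mul_neg, ← neg_add, hRW]; simp
      · rw [hWW, neg_mul, hRR, ← neg_add]
        congr 1
        push_cast
        module
    · rw [fromBlocks_multiply, fromBlocks_multiply, fromBlocks_add, ← fromBlocks_zero]
      congr 1 <;> simp [hRR, hRW]
    · simp [fromBlocks_multiply, hRR]
    · simp [fromBlocks_conjTranspose, hR]
    · simp [hsum]
    · simpa using hcard
    · have h₁ (i j : ι) : r i ≤ B + r j := by have := hB i; omega
      have h₂ (i j : ι) : r j < B + r i := by have := hB j; omega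
      have hll := htri a b (fun i j ↦ m (.inl i) (.inl j)) (fun i j hij ↦ hma _ _ hij)
        fun i j hij ↦ hmb _ _ hij
      have hrr := htri a b (fun i j ↦ m (.inr i) (.inr j))
        (fun i j hij ↦ hma _ _ (Nat.add_le_add_left hij B))
        fun i j hij ↦ hmb _ _ (Nat.add_lt_add_left hij B)
      have hlr (i j : ι) : m (.inl i) (.inr j) = a := hma _ _ (h₁ i j)
      have hrl (i j : ι) : m (.inr i) (.inl j) = b := hmb _ _ (h₂ i j)
      simp only [Fintype.sum_sum_type, fromBlocks_apply₁₁, fromBlocks_apply₁₂, fromBlocks_apply₂₁,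
        fromBlocks_apply₂₂, hlr, hrl, Finset.sum_add_distrib, hll, hrr, Matrix.neg_apply, mul_neg,
        Finset.sum_neg_distrib, ← Finset.mul_sum, hsum, Fintype.card_sum]
      push_cast
      ring

theorem exists_seq_dividedDifference_near {g : ℝ → ℂ} {K : ℝ} (hK : 0 ≤ K)
    (hg : ∀ t, ‖g t - g 0‖ ≤ K * |t|) {c : ℕ → ℂ}
    (hc : ∀ k, MapClusterPt (c k) (𝓝[≠] 0) fun t : ℝ ↦ (g t - g 0) / t) {ε : ℝ} (hε : 0 < ε) :
    ∃ T : ℕ → ℝ, T.Injective ∧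
      ∀ i j, i < j → ‖(g (T i) - g (T j)) / (T i - T j) - c i‖ ≤ ε := by
  have hex (k : ℕ) (η : ℝ) (hη : 0 < η) :
      ∃ t : ℝ, t ≠ 0 ∧ |t| < η ∧ ‖(g t - g 0) / t - c k‖ < ε / 2 := by
    have hnear : ∀ᶠ t : ℝ in 𝓝[≠] 0, t ≠ 0 ∧ |t| < η := by
      filter_upwards [self_mem_nhdsWithin,
        mem_nhdsWithin_of_mem_nhds (Metric.ball_mem_nhds (0 : ℝ) hη)] with t h₀ h₁
      exact ⟨h₀, by simpa using h₁⟩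
    obtain ⟨t, ht, h₀, h₁⟩ := ((mapClusterPt_iff_frequently.1 (hc k) _
      (Metric.ball_mem_nhds (c k) (half_pos hε))).and_eventually hnear).exists
    exact ⟨t, h₀, h₁, by simpa [dist_eq_norm] using ht⟩
  choose! S hS₀ hS₁ hS₂ using hex
  let δ : ℝ := min (1 / 2) (ε / (8 * (K + 1)))
  have hδ : 0 < δ := by positivity
  have hδ₂ : δ ≤ 1 / 2 := min_le_left _ _
  have hδε : 4 * K * δ ≤ ε / 2 := by
    have : δ ≤ ε / (8 * (K + 1)) := min_le_right _ _
    rw [le_div_iff₀ (by positivity)] at this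
    nlinarith
  obtain ⟨T, hT_zero, hT_succ⟩ :
      ∃ T : ℕ → ℝ, T 0 = S 0 1 ∧ ∀ k, T (k + 1) = S (k + 1) (δ * |T k|) :=
    ⟨Nat.rec (S 0 1) fun k t ↦ S (k + 1) (δ * |t|), rfl, fun _ ↦ rfl⟩
  have hT₀ (k : ℕ) : T k ≠ 0 := by
    induction k with
    | zero => exact hT_zero ▸ hS₀ 0 1 one_pos
    | succ k ih => exact hT_succ k ▸ hS₀ _ _ (by positivity)
  have hη (k : ℕ) : 0 < δ * |T k| := mul_pos hδ (abs_pos.2 (hT₀ k))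
  have hTq (k : ℕ) : ‖(g (T k) - g 0) / (T k : ℂ) - c k‖ < ε / 2 := by
    cases k with
    | zero => exact hT_zero ▸ hS₂ 0 1 one_pos
    | succ k => exact hT_succ k ▸ hS₂ _ _ (hη k)
  have hT_lt (k : ℕ) : |T (k + 1)| < δ * |T k| := by
    rw [hT_succ]
    exact hS₁ _ _ (hη k)
  have hT_lt' (i j : ℕ) (hij : i < j) : |T j| < δ * |T i| := by
    induction j, hij using Nat.le_induction with
    | base => exact hT_lt i
    | succ j _ ih =>
      have := hT_lt j
      nlinarith [abs_nonneg (T j)]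
  refine ⟨T, ?_, fun i j hij ↦ ?_⟩
  · refine Function.Injective.of_lt_imp_ne fun i j hij heq ↦ ?_
    have := hT_lt' i j hij
    rw [heq] at this
    nlinarith [abs_nonneg (T j)]
  · have hx := hT₀ i
    have hy := hT₀ j
    have hxy := hT_lt' i j hij
    have hgap : |T i| / 2 ≤ |T i - T j| := by
      have := abs_sub_abs_le_abs_sub (T i) (T j)
      nlinarith [abs_nonneg (T i)]
    have hq (k : ℕ) : ‖(g (T k) - g 0) / T k‖ ≤ K := by
      rw [norm_div, Complex.norm_real, Real.norm_eq_abs, div_le_iff₀ (abs_pos.2 (hT₀ k))]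
      exact hg _
    have hpos : 0 < |T i - T j| := by
      have := abs_pos.2 hx
      linarith
    have hne : (T i - T j : ℂ) ≠ 0 := by exact_mod_cast abs_pos.1 hpos
    have hsplit : (g (T i) - g (T j)) / (T i - T j) - c i =
        ((g (T i) - g 0) / T i - (g (T j) - g 0) / T j) * (T j / (T i - T j)) +
          ((g (T i) - g 0) / T i - c i) := by
      have hx' : (T i : ℂ) ≠ 0 := by exact_mod_cast hx
      have hy' : (T j : ℂ) ≠ 0 := by exact_mod_cast hy
      field_simp
      ring
    have hratio : ‖(T j / (T i - T j) : ℂ)‖ ≤ 2 * δ := by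
      rw [← Complex.ofReal_sub, ← Complex.ofReal_div, Complex.norm_real, Real.norm_eq_abs, abs_div,
        div_le_iff₀ hpos]
      nlinarith
    rw [hsplit]
    calc _ ≤ (K + K) * (2 * δ) + ε / 2 := by
          refine (norm_add_le _ _).trans (add_le_add ?_ (hTq i).le)
          rw [norm_mul]
          exact mul_le_mul ((norm_sub_le _ _).trans (add_le_add (hq i) (hq j))) hratio
            (norm_nonneg _) (by positivity)
      _ ≤ ε := by linarith

namespace OperatorLipschitz

variable {f : ℂ → ℂ} {C : ℝ}

theorem norm_sub_mul_sqrt_le (h : OperatorLipschitz f C) (hf : Continuous f) (hC : 0 ≤ C)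
    {ζ ξ a b : ℂ}
    (ha : MapClusterPt a (𝓝[≠] 0) fun t : ℝ ↦ (f (ζ + t * ξ) - f ζ) / t)
    (hb : MapClusterPt b (𝓝[≠] 0) fun t : ℝ ↦ (f (ζ + t * ξ) - f ζ) / t) (n : ℕ) :
    ‖a - b‖ * √(n + 1) ≤ 2 * (C * ‖ξ‖) := by
  obtain ⟨ι, _, _, r, B, W, R, hr, -, hW, hWW, -, -, -, -, hcard, htri⟩ :=
    exists_large_triangular_truncation n
  have hn : (0 : ℝ) < n + 1 := by positivity
  let Y : Matrix (ι ⊕ ι) (ι ⊕ ι) ℂ := fromBlocks 0 W Wᴴ 0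
  have hY : Y.IsHermitian := by simp [Y, IsHermitian, fromBlocks_conjTranspose]
  have hYnorm : ‖Y‖ ≤ √(n + 1) := by
    have hYY : Yᴴ * Y = ((n + 1 : ℝ) : ℂ) • 1 := by
      rw [hY.eq, ← fromBlocks_one, fromBlocks_smul]
      simp [Y, fromBlocks_multiply, hW, hWW]
    have hsq := l2_opNorm_conjTranspose_mul_self Y
    have hone : ‖(1 : Matrix (ι ⊕ ι) (ι ⊕ ι) ℂ)‖ ≤ 1 := by
      rw [cstar_norm_def, map_one]
      exact ContinuousLinearMap.norm_id_le
    rw [hYY, norm_smul, Complex.norm_real, Real.norm_of_nonneg hn.le] at hsq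
    refine Real.le_sqrt_of_sq_le ?_
    nlinarith
  suffices hε : ∀ ε > 0, ‖a - b‖ * ((n + 1) / 2 * Fintype.card ι) ≤
      C * (‖ξ‖ * √(n + 1)) * Fintype.card ι + ε * ∑ i, ∑ j, ‖W i j‖ by
    have hlim : ‖a - b‖ * ((n + 1) / 2 * Fintype.card ι) ≤
        C * (‖ξ‖ * √(n + 1)) * Fintype.card ι := by
      have htend : Tendsto (fun ε : ℝ ↦ C * (‖ξ‖ * √(n + 1)) * Fintype.card ι +
          ε * ∑ i, ∑ j, ‖W i j‖) (𝓝[>] 0) (𝓝 (C * (‖ξ‖ * √(n + 1)) * Fintype.card ι)) := by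
        refine tendsto_nhdsWithin_of_tendsto_nhds (Continuous.tendsto' (by fun_prop) _ _ ?_)
        simp
      exact ge_of_tendsto htend (eventually_mem_nhdsWithin.mono hε)
    have hcard' : (0 : ℝ) < Fintype.card ι := by exact_mod_cast hcard
    have hsqrt : 0 < √((n : ℝ) + 1) := Real.sqrt_pos.2 hn
    have hmul : √((n : ℝ) + 1) * √(n + 1) = n + 1 := Real.mul_self_sqrt hn.le
    refine le_of_mul_le_mul_right ?_ (mul_pos hsqrt hcard')
    calc _ = 2 * (‖a - b‖ * ((n + 1) / 2 * Fintype.card ι)) := by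
          linear_combination (‖a - b‖ * Fintype.card ι) * hmul
      _ ≤ _ := by linarith
  intro ε hε
  let K : ℝ := C * ‖ξ‖
  obtain ⟨T, hT, hnear⟩ := exists_seq_dividedDifference_near (g := fun t ↦ f (ζ + t * ξ)) (K := K)
    (c := fun k ↦ if Even k then a else b) (by positivity) (fun t ↦ by
      refine (h.norm_sub_le _ _).trans_eq ?_
      simp [K]
      ring) (fun k ↦ by split_ifs <;> simpa) hε
  let t : ι ⊕ ι → ℝ := Sum.elim (fun i ↦ T (2 * r i)) (fun i ↦ T (2 * r i + 1))
  have ht : t.Injective := by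
    refine Function.Injective.sumElim (fun i j hij ↦ hr ?_) (fun i j hij ↦ hr ?_) fun i j hij ↦ ?_
    all_goals
      have := hT hij
      omega
  have hschur := (norm_sum_upperRight_le _).trans (mul_le_mul_of_nonneg_right
    (h.norm_dividedDifference_mul_le hf ζ ξ ht hY (by rintro (i | i) <;> rfl))
    (Nat.cast_nonneg (Fintype.card ι)))
  simp only [of_apply, Y, fromBlocks_apply₁₂, t, Sum.elim_inl, Sum.elim_inr] at hschur
  have hentry (i j : ι) : ‖(if r i ≤ r j then a else b) -
      (f (ζ + T (2 * r i) * ξ) - f (ζ + T (2 * r j + 1) * ξ)) /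
        (T (2 * r i) - T (2 * r j + 1))‖ ≤ ε := by
    rw [norm_sub_rev]
    split_ifs with hij
    · simpa using hnear (2 * r i) (2 * r j + 1) (by omega)
    · have := hnear (2 * r j + 1) (2 * r i) (by omega)
      rw [← neg_sub (f _), ← neg_sub (T (2 * r i) : ℂ), neg_div_neg_eq] at this
      simpa using this
  have hdiff : ‖∑ i, ∑ j, (if r i ≤ r j then a else b) * W i j -
      ∑ i, ∑ j, (f (ζ + T (2 * r i) * ξ) - f (ζ + T (2 * r j + 1) * ξ)) /
        (T (2 * r i) - T (2 * r j + 1)) * W i j‖ ≤ ε * ∑ i, ∑ j, ‖W i j‖ := by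
    simp only [← Finset.sum_sub_distrib, ← sub_mul, Finset.mul_sum]
    refine norm_sum_le_of_le _ fun i _ ↦ norm_sum_le_of_le _ fun j _ ↦ ?_
    rw [norm_mul]
    exact mul_le_mul_of_nonneg_right (hentry i j) (norm_nonneg _)
  have hval : ‖∑ i, ∑ j, (if r i ≤ r j then a else b) * W i j‖ =
      ‖a - b‖ * ((n + 1) / 2 * Fintype.card ι) := by
    have hnonneg : (0 : ℝ) ≤ (n + 1) / 2 * Fintype.card ι := by positivity
    rw [htri a b _ (fun i j hij ↦ if_pos hij) fun i j hij ↦ if_neg hij.not_ge, norm_mul,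
      ← Complex.norm_of_nonneg hnonneg]
    simp
  rw [← hval]
  have hYle : C * (‖ξ‖ * ‖Y‖) * Fintype.card ι ≤ C * (‖ξ‖ * √(n + 1)) * Fintype.card ι := by
    gcongr
  linarith [norm_le_norm_add_norm_sub' (∑ i, ∑ j, (if r i ≤ r j then a else b) * W i j)
    (∑ i, ∑ j, (f (ζ + T (2 * r i) * ξ) - f (ζ + T (2 * r j + 1) * ξ)) /
        (T (2 * r i) - T (2 * r j + 1)) * W i j)]

theorem eq_of_mapClusterPt (h : OperatorLipschitz f C) (hf : Continuous f) (hC : 0 ≤ C)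
    {ζ ξ a b : ℂ}
    (ha : MapClusterPt a (𝓝[≠] 0) fun t : ℝ ↦ (f (ζ + t * ξ) - f ζ) / t)
    (hb : MapClusterPt b (𝓝[≠] 0) fun t : ℝ ↦ (f (ζ + t * ξ) - f ζ) / t) : a = b := by
  by_contra hab
  have hpos : 0 < ‖a - b‖ := norm_pos_iff.2 (sub_ne_zero.2 hab)
  obtain ⟨n, hn⟩ := exists_nat_gt ((2 * (C * ‖ξ‖) / ‖a - b‖) ^ 2)
  have hlt : 2 * (C * ‖ξ‖) / ‖a - b‖ < √(n + 1) := Real.lt_sqrt_of_sq_lt (by linarith)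
  rw [div_lt_iff₀ hpos] at hlt
  linarith [h.norm_sub_mul_sqrt_le hf hC ha hb n]

end OperatorLipschitz

/-- Theorem 3.3 (Theorem `diflip`): an operator Lipschitz function on `ℂ` has a finite
derivative at every point in every direction. -/
theorem stmt_2 (f : ℂ → ℂ) (hf : Continuous f) (C : ℝ)
    (hlip : ∀ (H : Type) [NormedAddCommGroup H] [InnerProductSpace ℂ H] [CompleteSpace H]
      (N₁ N₂ : H →L[ℂ] H), IsStarNormal N₁ → IsStarNormal N₂ →
      ‖cfc f N₁ - cfc f N₂‖ ≤ C * ‖N₁ - N₂‖) :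
    ∀ ζ ξ : ℂ, ∃ L : ℂ,
      Filter.Tendsto (fun t : ℝ => (f (ζ + (t : ℂ) * ξ) - f ζ) / (t : ℂ))
        (nhdsWithin 0 {0}ᶜ) (nhds L) := by
  intro ζ ξ
  have h : OperatorLipschitz f C := hlip
  have hC : 0 ≤ C := by simpa using (norm_nonneg _).trans (h.norm_sub_le 1 0)
  have hmem (t : ℝ) : (f (ζ + t * ξ) - f ζ) / t ∈ Metric.closedBall (0 : ℂ) (C * ‖ξ‖) := by
    have hle := h.norm_sub_le (ζ + t * ξ) ζ
    rw [add_sub_cancel_left, norm_mul, Complex.norm_real] at hle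
    rw [mem_closedBall_zero_iff, norm_div, Complex.norm_real]
    exact div_le_of_le_mul₀ (norm_nonneg _) (by positivity) (by linarith)
  have hcompact := isCompact_closedBall (0 : ℂ) (C * ‖ξ‖)
  obtain ⟨L, -, hL⟩ := hcompact.exists_mapClusterPt (f := 𝓝[≠] (0 : ℝ))
    (u := fun t : ℝ ↦ (f (ζ + t * ξ) - f ζ) / t) (tendsto_principal.2 (.of_forall hmem))
  exact ⟨L, hcompact.tendsto_nhds_of_unique_mapClusterPt (.of_forall hmem)
    fun L' _ hL' ↦ h.eq_of_mapClusterPt hf hC hL' hL⟩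
end

section
/- There exist constants C₁, C₂ > 0 with the following property for all δ, r with 0 < δ ≤ r. (Upper bound) For every complex Hilbert space H, every bounded normal operator N on H with ‖N‖ ≤ r (equivalently spectrum in the closed disk of radius r), and every bounded operator R on H with ‖R‖ ≤ 1 and ‖NR − RN‖ ≤ δ, one has ‖N*R − RN*‖ ≤ C₂·δ·log(2r/δ). (Lower bound) There exist a separable complex Hilbert space H, a bounded normal operator N on H with spectrum in the closed disk of radius r, and a bounded operator R on H with ‖R‖ ≤ 1 and ‖NR − RN‖ ≤ δ such that ‖N*R − RN*‖ ≥ C₁·δ·log(2r/δ). -/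
section FugledeFlow

open NormedSpace

variable {A : Type*} [CStarAlgebra A]

/-- Conjugation of `X` by `exp (a N + b N*)`. -/
noncomputable def expConj (N : A) (a b : ℂ) (X : A) : A :=
  exp (a • N + b • star N) * X * exp (-(a • N + b • star N))

theorem hasDerivAt_exp_smul_add_smul {N M : A} (hNM : Commute N M) {a b : ℝ → ℂ}
    {a' b' : ℂ} {t : ℝ} (ha : HasDerivAt a a' t) (hb : HasDerivAt b b' t) :
    HasDerivAt (fun u => exp (a u • N + b u • M))
      (exp (a t • N + b t • M) * (a' • N + b' • M)) t := by
  let _ : NormedAlgebra ℚ A := NormedAlgebra.restrictScalars ℚ ℂ A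
  have hc : ∀ u, exp (a u • N + b u • M) = exp (a u • N) * exp (b u • M) := fun u =>
    exp_add_of_commute ((hNM.smul_left _).smul_right _)
  have h1 := (hasDerivAt_exp_smul_const (𝕂 := ℂ) N (a t)).scomp t ha
  have h2 := (hasDerivAt_exp_smul_const (𝕂 := ℂ) M (b t)).scomp t hb
  have h := h1.mul h2
  have hcomm : N * exp (b t • M) = exp (b t • M) * N :=
    ((hNM.smul_right (b t)).exp_right).eq
  rw [hc t]
  refine (h.congr_deriv ?_).congr_of_eventuallyEq (Filter.Eventually.of_forall hc)
  simp only [Function.comp, smul_mul_assoc, mul_smul_comm, mul_add, mul_assoc, hcomm]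

theorem commute_exp_smul_add_smul {N M P : A} (h₁ : Commute P N) (h₂ : Commute P M) (a b : ℂ) :
    Commute P (exp (a • N + b • M)) :=
  ((h₁.smul_right a).add_right (h₂.smul_right b)).exp_right

theorem hasDerivAt_expConj {N : A} (hN : IsStarNormal N) (X : A) {a b : ℝ → ℂ}
    {a' b' : ℂ} {t : ℝ} (ha : HasDerivAt a a' t) (hb : HasDerivAt b b' t) :
    HasDerivAt (fun u => expConj N (a u) (b u) X)
      (expConj N (a t) (b t) (a' • (N * X - X * N) + b' • (star N * X - X * star N))) t := by
  have hc : Commute N (star N) := hN.star_comm_self.symm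
  have h1 := hasDerivAt_exp_smul_add_smul hc ha hb
  have h2 := hasDerivAt_exp_smul_add_smul hc ha.fun_neg hb.fun_neg
  have hneg : ∀ u, (-a u) • N + (-b u) • star N = -(a u • N + b u • star N) := fun u => by
    simp only [neg_smul]; abel
  simp only [hneg] at h2
  have h := (h1.mul_const X).mul h2
  refine h.congr_deriv ?_
  have e1 : Commute N (exp (-(a t • N + b t • star N))) := by
    rw [← hneg]; exact commute_exp_smul_add_smul (Commute.refl N) hc _ _
  have e2 : Commute (star N) (exp (-(a t • N + b t • star N))) := by
    rw [← hneg]; exact commute_exp_smul_add_smul hc.symm (Commute.refl _) _ _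
  rw [expConj]
  generalize exp (-(a t • N + b t • star N)) = V at e1 e2 ⊢
  have e3 : V * (-a' • N + -b' • star N)
      = -(a' • N + b' • star N) * V := by
    simp only [mul_add, add_mul, neg_add, neg_smul, neg_mul, mul_neg, smul_mul_assoc,
      mul_smul_comm, e1.eq, e2.eq]
  rw [e3]
  simp only [mul_add, add_mul, mul_sub, sub_mul, smul_sub, smul_mul_assoc,
    mul_smul_comm, neg_mul, mul_neg, mul_assoc, neg_add]
  abel

theorem continuous_expConj (N X : A) {α : Type*} [TopologicalSpace α] {a b : α → ℂ}
    (ha : Continuous a) (hb : Continuous b) :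
    Continuous (fun u => expConj N (a u) (b u) X) := by
  let _ : NormedAlgebra ℚ A := NormedAlgebra.restrictScalars ℚ ℂ A
  unfold expConj
  have h : Continuous (exp : A → A) := exp_continuous
  have h0 : Continuous fun u => a u • N + b u • star N := by fun_prop
  exact ((h.comp h0).mul continuous_const).mul (h.comp h0.neg)

theorem expConj_add (N : A) (a b : ℂ) (X Y : A) :
    expConj N a b (X + Y) = expConj N a b X + expConj N a b Y := by
  simp [expConj, mul_add, add_mul]

theorem expConj_smul (N : A) (a b c : ℂ) (X : A) :
    expConj N a b (c • X) = c • expConj N a b X := by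
  simp [expConj]

theorem expConj_neg (N : A) (a b : ℂ) (X : A) : expConj N a b (-X) = -expConj N a b X := by
  simp [expConj]

theorem norm_expConj (N : A) (w : ℂ) (X : A) :
    ‖expConj N (-star w) w X‖ = ‖X‖ := by
  let _ : NormedAlgebra ℚ A := NormedAlgebra.restrictScalars ℚ ℂ A
  set S : A := (-star w) • N + w • star N with hS
  have hstar : star S = -S := by
    simp only [hS, star_add, star_smul, star_neg, star_star, neg_smul]
    abel
  have hu : exp S ∈ unitary A := by
    rw [Unitary.mem_iff, star_exp, hstar, ← exp_add_of_commute (Commute.refl S).neg_left,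
      ← exp_add_of_commute (Commute.refl S).neg_right]
    simp
  have hu' : exp (-S) ∈ unitary A := by
    have := Unitary.star_mem hu
    rwa [star_exp, hstar] at this
  rw [expConj, CStarRing.norm_mul_mem_unitary _ hu', CStarRing.norm_mem_unitary_mul _ hu]

theorem norm_commutator_le (X Y : A) : ‖X * Y - Y * X‖ ≤ 2 * ‖X‖ * ‖Y‖ := by
  have := norm_sub_le (X * Y) (Y * X)
  nlinarith [norm_mul_le X Y, norm_mul_le Y X]

theorem norm_expConj_sub_le {N : A} (hN : IsStarNormal N) (w : ℂ) (X : A) :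
    ‖expConj N (-star w) w X - X‖ ≤ 4 * ‖w‖ * ‖N‖ * ‖X‖ := by
  set f : ℝ → A := fun u => expConj N (-star ((u : ℂ) * w)) ((u : ℂ) * w) X with hf
  have hb : ∀ u : ℝ, HasDerivAt (fun u : ℝ => (u : ℂ) * w) w u := fun u => by
    simpa using (Complex.ofRealCLM.hasDerivAt (x := u)).mul_const w
  have ha : ∀ u : ℝ, HasDerivAt (fun u : ℝ => -star ((u : ℂ) * w)) (-star w) u := fun u => by
    simpa using ((Complex.ofRealCLM.hasDerivAt (x := u)).mul_const (star w)).fun_neg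
  have hd := fun u : ℝ => hasDerivAt_expConj hN X (ha u) (hb u)
  have h := Convex.norm_image_sub_le_of_norm_hasDerivWithin_le (s := Set.univ) (x := 0) (y := 1)
    (C := 4 * ‖w‖ * ‖N‖ * ‖X‖) (fun u _ => (hd u).hasDerivWithinAt) (fun u _ => ?_)
    convex_univ trivial trivial
  · simpa [expConj] using h
  · rw [norm_expConj]
    refine (norm_add_le _ _).trans ?_
    rw [norm_smul, norm_smul, norm_neg, norm_star]
    have h1 := norm_commutator_le N X
    have h2 := norm_commutator_le (star N) X
    rw [norm_star] at h2
    nlinarith [norm_nonneg w]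

/-- The unitary conjugation of `X` by `exp (w N* - w̄ N)`, where `w = exp (t + iθ)`. -/
noncomputable def polarConj (N : A) (t θ : ℝ) (X : A) : A :=
  expConj N (-star (Complex.exp (t + θ * Complex.I))) (Complex.exp (t + θ * Complex.I)) X

/-- The conjugation `polarConj` divided by `w = exp (t + iθ)`. -/
noncomputable def polarFlow (N R : A) (t θ : ℝ) : A :=
  Complex.exp (-(t + θ * Complex.I)) • polarConj N t θ R

theorem norm_cexp_polar (t θ : ℝ) : ‖Complex.exp (t + θ * Complex.I)‖ = Real.exp t := by
  simp [Complex.norm_exp]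

theorem norm_cexp_neg_polar (t θ : ℝ) :
    ‖Complex.exp (-(t + θ * Complex.I))‖ = Real.exp (-t) := by
  simp [Complex.norm_exp]

theorem star_cexp_polar (t θ : ℝ) :
    star (Complex.exp (t + θ * Complex.I)) = Complex.exp (t - θ * Complex.I) := by
  simp [← Complex.exp_conj, sub_eq_add_neg]

theorem hasDerivAt_polarFlow_left {N : A} (hN : IsStarNormal N) (R : A) (t θ : ℝ) :
    HasDerivAt (fun u => polarFlow N R u θ)
      (polarConj N t θ (star N * R - R * star N)
        - Complex.exp (-(2 * θ * Complex.I)) • polarConj N t θ (N * R - R * N)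
        - polarFlow N R t θ) t := by
  have h0 : HasDerivAt (fun u : ℝ => (u : ℂ) + θ * Complex.I) 1 t := by
    simpa using (Complex.ofRealCLM.hasDerivAt (x := t)).add_const (θ * Complex.I)
  have h1 : HasDerivAt (fun u : ℝ => (u : ℂ) - θ * Complex.I) 1 t := by
    simpa using (Complex.ofRealCLM.hasDerivAt (x := t)).sub_const (θ * Complex.I)
  have hb := h0.cexp
  have ha := h1.cexp.fun_neg
  have hc := h0.fun_neg.cexp
  have h := hc.smul (hasDerivAt_expConj hN R ha hb)
  simp only [polarFlow, polarConj, star_cexp_polar]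
  refine h.congr_deriv ?_
  generalize N * R - R * N = K, star N * R - R * star N = Q
  have e1 : Complex.exp (-(t + θ * Complex.I)) * Complex.exp (t + θ * Complex.I) = 1 := by
    rw [← Complex.exp_add]; simp
  have e2 : Complex.exp (-(t + θ * Complex.I)) * Complex.exp (t - θ * Complex.I)
      = Complex.exp (-(2 * θ * Complex.I)) := by
    rw [← Complex.exp_add]; congr 1; ring
  simp only [mul_one, expConj_add, expConj_smul, expConj_neg, smul_add, smul_neg, smul_smul,
    mul_neg, e1, e2, neg_smul, one_smul]
  abel

theorem hasDerivAt_polarFlow_right {N : A} (hN : IsStarNormal N) (R : A) (t θ : ℝ) :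
    HasDerivAt (fun u => polarFlow N R t u)
      (Complex.I • (polarConj N t θ (star N * R - R * star N)
        + Complex.exp (-(2 * θ * Complex.I)) • polarConj N t θ (N * R - R * N)
        - polarFlow N R t θ)) θ := by
  have h0 : HasDerivAt (fun u : ℝ => (t : ℂ) + u * Complex.I) Complex.I θ := by
    simpa using ((Complex.ofRealCLM.hasDerivAt (x := θ)).mul_const Complex.I).const_add (t : ℂ)
  have h1 : HasDerivAt (fun u : ℝ => (t : ℂ) - u * Complex.I) (-Complex.I) θ := by
    simpa using ((Complex.ofRealCLM.hasDerivAt (x := θ)).mul_const Complex.I).const_sub (t : ℂ)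
  have hb := h0.cexp
  have ha := h1.cexp.fun_neg
  have hc := h0.fun_neg.cexp
  have h := hc.smul (hasDerivAt_expConj hN R ha hb)
  simp only [polarFlow, polarConj, star_cexp_polar]
  refine h.congr_deriv ?_
  generalize N * R - R * N = K, star N * R - R * star N = Q
  have e1 : Complex.exp (-(t + θ * Complex.I)) * Complex.exp (t + θ * Complex.I) = 1 := by
    rw [← Complex.exp_add]; simp
  have e2 : Complex.exp (-(t + θ * Complex.I)) * Complex.exp (t - θ * Complex.I)
      = Complex.exp (-(2 * θ * Complex.I)) := by
    rw [← Complex.exp_add]; congr 1; ring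
  simp only [expConj_add, expConj_smul, smul_add, smul_sub, smul_smul, mul_neg, neg_neg,
    ← mul_assoc, e1, e2, neg_smul, one_mul]
  rw [mul_comm (Complex.exp (-(t + θ * Complex.I))) Complex.I,
    mul_comm (Complex.exp (-(2 * θ * Complex.I))) Complex.I]
  abel

theorem continuous_polarConj (N X : A) : Continuous fun p : ℝ × ℝ => polarConj N p.1 p.2 X :=
  continuous_expConj N X (by fun_prop) (by fun_prop)

theorem continuous_polarFlow (N R : A) : Continuous fun p : ℝ × ℝ => polarFlow N R p.1 p.2 :=
  Continuous.smul (by fun_prop) (continuous_polarConj N R)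

theorem norm_polarConj (N : A) (t θ : ℝ) (X : A) : ‖polarConj N t θ X‖ = ‖X‖ :=
  norm_expConj N _ X

theorem norm_polarFlow (N : A) (t θ : ℝ) (X : A) :
    ‖polarFlow N X t θ‖ = Real.exp (-t) * ‖X‖ := by
  rw [polarFlow, norm_smul, norm_polarConj, norm_cexp_neg_polar]

theorem integral_polarFlow {N : A} (hN : IsStarNormal N) (R : A) (t : ℝ) :
    ∫ θ in (0 : ℝ)..(2 * Real.pi), polarFlow N R t θ
      = ∫ θ in (0 : ℝ)..(2 * Real.pi), (polarConj N t θ (star N * R - R * star N)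
        + Complex.exp (-(2 * θ * Complex.I)) • polarConj N t θ (N * R - R * N)) := by
  have hc : ∀ X : A, Continuous fun θ : ℝ => polarConj N t θ X := fun X =>
    (continuous_polarConj N X).comp (by fun_prop : Continuous fun θ : ℝ => (t, θ))
  have hf : Continuous fun θ : ℝ => polarFlow N R t θ :=
    (continuous_polarFlow N R).comp (by fun_prop : Continuous fun θ : ℝ => (t, θ))
  have hg : Continuous fun θ : ℝ => polarConj N t θ (star N * R - R * star N)
        + Complex.exp (-(2 * θ * Complex.I)) • polarConj N t θ (N * R - R * N) :=
    (hc _).add (Continuous.smul (by fun_prop) (hc _))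
  have hper : polarFlow N R t (2 * Real.pi) = polarFlow N R t 0 := by
    have e1 : Complex.exp (t + (2 * Real.pi : ℝ) * Complex.I) = Complex.exp t := by
      push_cast; rw [Complex.exp_add, Complex.exp_two_pi_mul_I, mul_one]
    rw [polarFlow, polarFlow, polarConj, polarConj, Complex.exp_neg, Complex.exp_neg, e1]
    simp
  have h := intervalIntegral.integral_eq_sub_of_hasDerivAt
    (fun θ _ => hasDerivAt_polarFlow_right hN R t θ)
    (((hg.sub hf).const_smul Complex.I).intervalIntegrable 0 (2 * Real.pi))
  rw [hper, sub_self, intervalIntegral.integral_smul, smul_eq_zero_iff_right Complex.I_ne_zero,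
    intervalIntegral.integral_sub (hg.intervalIntegrable _ _) (hf.intervalIntegrable _ _),
    sub_eq_zero] at h
  exact h.symm

theorem hasDerivAt_integral_polarFlow {N : A} (hN : IsStarNormal N) (R : A) (t : ℝ) :
    HasDerivAt (fun u => ∫ θ in (0 : ℝ)..(2 * Real.pi), polarFlow N R u θ)
      (∫ θ in (0 : ℝ)..(2 * Real.pi),
        (-2 * Complex.exp (-(2 * θ * Complex.I))) • polarConj N t θ (N * R - R * N)) t := by
  have hc : ∀ X : A, ∀ t : ℝ, Continuous fun θ : ℝ => polarConj N t θ X := fun X t =>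
    (continuous_polarConj N X).comp (by fun_prop : Continuous fun θ : ℝ => (t, θ))
  have hf : ∀ t : ℝ, Continuous fun θ : ℝ => polarFlow N R t θ := fun t =>
    (continuous_polarFlow N R).comp (by fun_prop : Continuous fun θ : ℝ => (t, θ))
  have he : ∀ X : A, Continuous fun θ : ℝ =>
      Complex.exp (-(2 * θ * Complex.I)) • polarConj N t θ X :=
    fun X => Continuous.smul (by fun_prop) (hc _ _)
  have h := intervalIntegral.hasDerivAt_integral_of_dominated_loc_of_deriv_le
    (𝕜 := ℝ) (μ := MeasureTheory.volume) (a := 0) (b := 2 * Real.pi)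
    (F := fun u θ => polarFlow N R u θ)
    (F' := fun t θ => polarConj N t θ (star N * R - R * star N)
        - Complex.exp (-(2 * θ * Complex.I)) • polarConj N t θ (N * R - R * N)
        - polarFlow N R t θ) (x₀ := t) (s := Metric.ball t 1)
    (bound := fun _ => ‖star N * R - R * star N‖ + ‖N * R - R * N‖ + Real.exp (-(t - 1)) * ‖R‖)
    (Metric.ball_mem_nhds t one_pos)
    (Filter.Eventually.of_forall fun u => (hf u).aestronglyMeasurable)
    ((hf t).intervalIntegrable _ _)
    (((hc _ t).sub (he _)).sub (hf t)).aestronglyMeasurable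
    (Filter.Eventually.of_forall fun θ _ u hu => ?_)
    (continuous_const.intervalIntegrable _ _)
    (Filter.Eventually.of_forall fun θ _ u _ => hasDerivAt_polarFlow_left hN R u θ)
  · refine h.2.congr_deriv ?_
    have hD : Continuous fun θ : ℝ => polarConj N t θ (star N * R - R * star N)
        - Complex.exp (-(2 * θ * Complex.I)) • polarConj N t θ (N * R - R * N) :=
      (hc _ t).sub (he _)
    have hS : Continuous fun θ : ℝ => polarConj N t θ (star N * R - R * star N)
        + Complex.exp (-(2 * θ * Complex.I)) • polarConj N t θ (N * R - R * N) :=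
      (hc _ t).add (he _)
    rw [intervalIntegral.integral_sub (hD.intervalIntegrable _ _)
      ((hf t).intervalIntegrable _ _), integral_polarFlow hN, ← intervalIntegral.integral_sub
      (hD.intervalIntegrable _ _) (hS.intervalIntegrable _ _)]
    congr 1
    ext θ
    rw [mul_smul, neg_smul, two_smul]
    abel
  · refine (norm_sub_le _ _).trans (add_le_add ((norm_sub_le _ _).trans (add_le_add ?_ ?_)) ?_)
    · rw [norm_polarConj]
    · have := norm_cexp_neg_polar 0 (2 * θ)
      simp only [Complex.ofReal_zero, zero_add, Complex.ofReal_mul, Complex.ofReal_ofNat,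
        neg_zero, Real.exp_zero] at this
      rw [norm_smul, norm_polarConj, this, one_mul]
    · rw [norm_polarFlow]
      rw [Metric.mem_ball, Real.dist_eq, abs_lt] at hu
      gcongr
      linarith [hu.1]

theorem norm_cexp_neg_two_mul_I (θ : ℝ) : ‖Complex.exp (-(2 * θ * Complex.I))‖ = 1 := by
  simp [Complex.norm_exp]

theorem norm_star_commutator_le_of_parameters {N : A} (hN : IsStarNormal N) (R : A) (t T : ℝ)
    (htT : t ≤ T) :
    ‖star N * R - R * star N‖ ≤ Real.exp (-T) * ‖R‖ + 2 * ‖N * R - R * N‖ * (T - t)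
      + 4 * Real.exp t * ‖N‖ * ‖star N * R - R * star N‖ + ‖N * R - R * N‖ := by
  set Q := star N * R - R * star N with hQ
  set K := N * R - R * N with hK
  set g : ℝ → A := fun u => ∫ θ in (0 : ℝ)..(2 * Real.pi), polarFlow N R u θ with hg
  have hpi : |2 * Real.pi - 0| = 2 * Real.pi := by
    rw [sub_zero, abs_of_pos Real.two_pi_pos]
  have hg' : ∀ u : ℝ, ‖∫ θ in (0 : ℝ)..(2 * Real.pi),
      (-2 * Complex.exp (-(2 * θ * Complex.I))) • polarConj N u θ K‖ ≤ 2 * ‖K‖ * (2 * Real.pi) := by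
    intro u
    conv_rhs => rw [← hpi]
    refine intervalIntegral.norm_integral_le_of_norm_le_const fun θ _ => ?_
    rw [norm_smul, norm_mul, norm_cexp_neg_two_mul_I, norm_polarConj]
    simp
  have h1 : ‖g t - g T‖ ≤ 2 * ‖K‖ * (2 * Real.pi) * ‖t - T‖ :=
    Convex.norm_image_sub_le_of_norm_hasDerivWithin_le (s := Set.univ) (x := T) (y := t)
      (fun u _ => (hasDerivAt_integral_polarFlow hN R u).hasDerivWithinAt)
      (fun u _ => hg' u) convex_univ trivial trivial
  have h2 : ‖g T‖ ≤ Real.exp (-T) * ‖R‖ * (2 * Real.pi) := by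
    rw [← hpi]
    exact intervalIntegral.norm_integral_le_of_norm_le_const fun θ _ => (norm_polarFlow N T θ R).le
  have hc : ∀ X : A, Continuous fun θ : ℝ => polarConj N t θ X := fun X =>
    (continuous_polarConj N X).comp (by fun_prop : Continuous fun θ : ℝ => (t, θ))
  have h3 : ‖g t - (2 * Real.pi) • Q‖
      ≤ (4 * Real.exp t * ‖N‖ * ‖Q‖ + ‖K‖) * (2 * Real.pi) := by
    have e : g t - (2 * Real.pi) • Q = ∫ θ in (0 : ℝ)..(2 * Real.pi),
        ((polarConj N t θ Q + Complex.exp (-(2 * θ * Complex.I)) • polarConj N t θ K) - Q) := by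
      have hS : Continuous fun θ : ℝ => polarConj N t θ Q
          + Complex.exp (-(2 * θ * Complex.I)) • polarConj N t θ K :=
        (hc _).add (Continuous.smul (by fun_prop) (hc _))
      rw [intervalIntegral.integral_sub (hS.intervalIntegrable _ _)
        (continuous_const.intervalIntegrable _ _), intervalIntegral.integral_const, sub_zero, hg]
      simp only [integral_polarFlow hN R t, hQ, hK]
    rw [e]
    conv_rhs => rw [← hpi]
    refine intervalIntegral.norm_integral_le_of_norm_le_const fun θ _ => ?_
    rw [add_sub_right_comm]
    refine (norm_add_le _ _).trans (add_le_add ?_ ?_)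
    · have := norm_expConj_sub_le hN (Complex.exp (t + θ * Complex.I)) Q
      rwa [norm_cexp_polar] at this
    · rw [norm_smul, norm_cexp_neg_two_mul_I, norm_polarConj, one_mul]
  have h4 : ‖(2 * Real.pi) • Q‖ ≤ ‖g T‖ + ‖g t - g T‖ + ‖g t - (2 * Real.pi) • Q‖ := by
    have : (2 * Real.pi) • Q = g T + (g t - g T) - (g t - (2 * Real.pi) • Q) := by abel
    calc _ = ‖g T + (g t - g T) - (g t - (2 * Real.pi) • Q)‖ := by rw [← this]
      _ ≤ _ := (norm_sub_le _ _).trans (add_le_add_left (norm_add_le _ _) _)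
  rw [norm_smul, Real.norm_of_nonneg Real.two_pi_pos.le] at h4
  rw [Real.norm_eq_abs, abs_of_nonpos (by linarith)] at h1
  refine le_of_mul_le_mul_left ?_ Real.two_pi_pos
  nlinarith

theorem norm_star_commutator_le {N R : A} (hN : IsStarNormal N) {δ r : ℝ} (hδ : 0 < δ)
    (hδr : δ ≤ r) (hNr : ‖N‖ ≤ r) (hR : ‖R‖ ≤ 1) (h : ‖N * R - R * N‖ ≤ δ) :
    ‖star N * R - R * star N‖ ≤ 20 * (δ * Real.log (2 * r / δ)) := by
  have hr : 0 < r := hδ.trans_le hδr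
  have hlog2 : (1 / 2 : ℝ) ≤ Real.log 2 := by linarith [Real.log_two_gt_d9]
  have hlog : Real.log 2 ≤ Real.log (2 * r / δ) :=
    Real.log_le_log two_pos (by rw [le_div_iff₀ hδ]; linarith)
  have hT : Real.exp (-(-Real.log δ)) = δ := by rw [neg_neg, Real.exp_log hδ]
  have ht : Real.exp (-Real.log (8 * r)) = (8 * r)⁻¹ := by
    rw [Real.exp_neg, Real.exp_log (by positivity)]
  have h8 : -Real.log δ - -Real.log (8 * r) = 2 * Real.log 2 + Real.log (2 * r / δ) := by
    rw [Real.log_div (by positivity) hδ.ne', Real.log_mul (by norm_num) hr.ne',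
      Real.log_mul two_ne_zero hr.ne', show (8 : ℝ) = 2 ^ 3 by norm_num, Real.log_pow]
    push_cast; ring
  have key := norm_star_commutator_le_of_parameters hN R (-Real.log (8 * r)) (-Real.log δ)
    (by linarith)
  rw [hT, ht, h8] at key
  set X := ‖star N * R - R * star N‖
  set L := Real.log (2 * r / δ)
  have h1 : 4 * (8 * r)⁻¹ * ‖N‖ * X ≤ X / 2 := by
    have : 4 * (8 * r)⁻¹ * ‖N‖ ≤ 1 / 2 := by
      calc 4 * (8 * r)⁻¹ * ‖N‖ ≤ 4 * (8 * r)⁻¹ * r := by gcongr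
        _ = 1 / 2 := by field_simp; norm_num
    nlinarith [norm_nonneg (star N * R - R * star N)]
  have h2 : 2 * ‖N * R - R * N‖ * (2 * Real.log 2 + L) ≤ 2 * δ * (3 * L) := by
    have : 2 * Real.log 2 + L ≤ 3 * L := by linarith
    have : 0 ≤ 2 * Real.log 2 + L := by linarith
    gcongr
  have h3 : δ * ‖R‖ ≤ δ := mul_le_of_le_one_right hδ.le hR
  nlinarith [mul_le_mul_of_nonneg_left (hlog2.trans hlog) hδ.le]

end FugledeFlow

section LatticeExample

open Finset

theorem norm_toEuclideanCLM_le {ι : Type*} [Fintype ι] [DecidableEq ι] (M : Matrix ι ι ℂ) {C : ℝ}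
    (hC : 0 ≤ C)
    (h : ∀ x : ι → ℂ, ∑ p, ‖∑ q, M p q * x q‖ ^ 2 ≤ C ^ 2 * ∑ q, ‖x q‖ ^ 2) :
    ‖Matrix.toEuclideanCLM (n := ι) (𝕜 := ℂ) M‖ ≤ C := by
  refine ContinuousLinearMap.opNorm_le_bound _ hC fun x => ?_
  refine le_of_sq_le_sq ?_ (by positivity)
  rw [mul_pow, EuclideanSpace.norm_sq_eq, EuclideanSpace.norm_sq_eq]
  exact h x

theorem integral_exp_int_mul_I (m : ℤ) :
    ∫ θ in (0 : ℝ)..(2 * Real.pi), Complex.exp (m * Complex.I * θ)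
      = if m = 0 then 2 * (Real.pi : ℂ) else 0 := by
  split_ifs with hm
  · simp [hm]
  · have hc : (m : ℂ) * Complex.I ≠ 0 := mul_ne_zero (by exact_mod_cast hm) Complex.I_ne_zero
    rw [integral_exp_mul_complex hc]
    have : (m : ℂ) * Complex.I * ((2 * Real.pi : ℝ) : ℂ) = m * (2 * Real.pi * Complex.I) := by
      push_cast; ring
    rw [this, Complex.exp_int_mul_two_pi_mul_I]
    simp

theorem integral_sawtooth_mul_exp (m : ℤ) :
    ∫ θ in (0 : ℝ)..(2 * Real.pi), ((Real.pi - θ : ℝ) : ℂ) * Complex.exp (m * Complex.I * θ)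
      = 2 * Real.pi * Complex.I * (m : ℂ)⁻¹ := by
  by_cases hm : m = 0
  · simp only [hm, Int.cast_zero, zero_mul, Complex.exp_zero, mul_one, inv_zero, mul_zero]
    rw [intervalIntegral.integral_ofReal, intervalIntegral.integral_sub (by simp) (by simp)]
    simp
    ring
  · have hm' : (m : ℂ) ≠ 0 := by exact_mod_cast hm
    set c : ℂ := (m : ℂ) * Complex.I with hc'
    have hc : c ≠ 0 := mul_ne_zero hm' Complex.I_ne_zero
    have hd : ∀ θ ∈ Set.uIcc (0 : ℝ) (2 * Real.pi), HasDerivAt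
        (fun θ : ℝ => ((Real.pi - θ : ℝ) : ℂ) * (Complex.exp (c * θ) / c)
          + Complex.exp (c * θ) / c ^ 2)
        (((Real.pi - θ : ℝ) : ℂ) * Complex.exp (c * θ)) θ := by
      intro θ _
      have h1 : HasDerivAt (fun θ : ℝ => ((Real.pi - θ : ℝ) : ℂ)) (-1) θ := by
        simpa using ((hasDerivAt_id θ).const_sub Real.pi).ofReal_comp
      have h2 : HasDerivAt (fun θ : ℝ => Complex.exp (c * θ)) (Complex.exp (c * θ) * c) θ := by
        have : HasDerivAt (fun θ : ℝ => c * (θ : ℂ)) c θ := by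
          simpa using (Complex.ofRealCLM.hasDerivAt (x := θ)).const_mul c
        exact this.cexp
      refine ((h1.mul (h2.div_const c)).add (h2.div_const (c ^ 2))).congr_deriv ?_
      field_simp
      ring
    rw [intervalIntegral.integral_eq_sub_of_hasDerivAt hd
      (Continuous.intervalIntegrable (by fun_prop) _ _)]
    have : c * ((2 * Real.pi : ℝ) : ℂ) = m * (2 * Real.pi * Complex.I) := by
      rw [hc']; push_cast; ring
    rw [this, Complex.exp_int_mul_two_pi_mul_I, hc']
    simp
    field_simp
    norm_num

theorem integral_norm_sq_trigPoly {m : ℕ} (x : Fin m → ℂ) :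
    ∫ θ in (0 : ℝ)..(2 * Real.pi), ‖∑ k, x k * Complex.exp (-(k * Complex.I * θ))‖ ^ 2
      = 2 * Real.pi * ∑ k, ‖x k‖ ^ 2 := by
  have h : ∀ θ : ℝ, ((‖∑ k, x k * Complex.exp (-(k * Complex.I * θ))‖ ^ 2 : ℝ) : ℂ)
      = ∑ j, ∑ k, (star (x j) * x k) *
        Complex.exp ((((j : ℕ) : ℤ) - ((k : ℕ) : ℤ) : ℤ) * Complex.I * θ) := by
    intro θ
    rw [Complex.ofReal_pow, ← Complex.conj_mul', map_sum, sum_mul_sum]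
    refine sum_congr rfl fun j _ => sum_congr rfl fun k _ => ?_
    rw [map_mul, ← Complex.exp_conj]
    simp only [map_neg, map_mul, Complex.conj_I, Complex.conj_ofReal, map_natCast, neg_neg, mul_neg,
      neg_mul]
    rw [mul_mul_mul_comm, ← Complex.exp_add]
    congr 2
    push_cast
    ring
  apply Complex.ofReal_injective
  rw [← intervalIntegral.integral_ofReal]
  simp only [h]
  rw [intervalIntegral.integral_finsetSum
    (fun j _ => Continuous.intervalIntegrable (by fun_prop) _ _), Complex.ofReal_mul,
    Complex.ofReal_sum, mul_sum]
  refine sum_congr rfl fun j _ => ?_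
  rw [intervalIntegral.integral_finsetSum
    (fun j _ => Continuous.intervalIntegrable (by fun_prop) _ _), sum_eq_single j]
  · rw [intervalIntegral.integral_const_mul, integral_exp_int_mul_I, Complex.ofReal_pow,
      ← Complex.conj_mul']
    simp
    ring
  · intro k _ hk
    rw [intervalIntegral.integral_const_mul, integral_exp_int_mul_I, if_neg, mul_zero]
    intro h0
    exact hk (Fin.ext (by omega))
  · simp

theorem norm_hilbert_form_le {m : ℕ} (x y : Fin m → ℂ) :
    ‖∑ j : Fin m, ∑ k : Fin m, star (y j) * ((((j : ℕ) : ℂ) - ((k : ℕ) : ℂ))⁻¹ * x k)‖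
      ≤ Real.pi / 2 * (∑ k, ‖x k‖ ^ 2 + ∑ j, ‖y j‖ ^ 2) := by
  set p : ℝ → ℂ := fun θ => ∑ k, x k * Complex.exp (-(k * Complex.I * θ)) with hp
  set q : ℝ → ℂ := fun θ => ∑ k, y k * Complex.exp (-(k * Complex.I * θ)) with hq
  have hpc : Continuous p := by fun_prop
  have hqc : Continuous q := by fun_prop
  have h1 : ∫ θ in (0 : ℝ)..(2 * Real.pi), ((Real.pi - θ : ℝ) : ℂ) * (star (q θ) * p θ)
      = 2 * Real.pi * Complex.I *
      ∑ j : Fin m, ∑ k : Fin m, star (y j) * ((((j : ℕ) : ℂ) - ((k : ℕ) : ℂ))⁻¹ * x k) := by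
    have e : ∀ θ : ℝ, ((Real.pi - θ : ℝ) : ℂ) * (star (q θ) * p θ) = ∑ j, ∑ k,
        (star (y j) * x k) * (((Real.pi - θ : ℝ) : ℂ) *
          Complex.exp ((((j : ℕ) : ℤ) - ((k : ℕ) : ℤ) : ℤ) * Complex.I * θ)) := by
      intro θ
      rw [hp, hq, star_sum, sum_mul_sum, mul_sum]
      simp only [mul_sum]
      refine sum_congr rfl fun j _ => sum_congr rfl fun k _ => ?_
      rw [star_mul', Complex.star_def, ← Complex.exp_conj]
      simp only [map_neg, map_mul, Complex.conj_I, Complex.conj_ofReal, map_natCast, neg_neg,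
        mul_neg, neg_mul]
      rw [mul_mul_mul_comm, ← Complex.exp_add, mul_left_comm]
      congr 3
      push_cast
      ring
    simp only [e]
    rw [intervalIntegral.integral_finsetSum
      (fun j _ => Continuous.intervalIntegrable (by fun_prop) _ _), mul_sum]
    refine sum_congr rfl fun j _ => ?_
    rw [intervalIntegral.integral_finsetSum
      (fun j _ => Continuous.intervalIntegrable (by fun_prop) _ _), mul_sum]
    refine sum_congr rfl fun k _ => ?_
    rw [intervalIntegral.integral_const_mul, integral_sawtooth_mul_exp]
    push_cast
    ring
  have h2 : ‖∫ θ in (0 : ℝ)..(2 * Real.pi), ((Real.pi - θ : ℝ) : ℂ) * (star (q θ) * p θ)‖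
      ≤ ∫ θ in (0 : ℝ)..(2 * Real.pi), Real.pi / 2 * (‖p θ‖ ^ 2 + ‖q θ‖ ^ 2) := by
    refine intervalIntegral.norm_integral_le_of_norm_le Real.two_pi_pos.le
      (Filter.Eventually.of_forall fun θ hθ => ?_)
      (Continuous.intervalIntegrable (by fun_prop) _ _)
    rw [norm_mul, norm_mul, norm_star, Complex.norm_real, Real.norm_eq_abs]
    have hθ' : |Real.pi - θ| ≤ Real.pi := abs_le.2 ⟨by linarith [hθ.2], by linarith [hθ.1]⟩
    have := two_mul_le_add_sq ‖q θ‖ ‖p θ‖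
    calc |Real.pi - θ| * (‖q θ‖ * ‖p θ‖) ≤ Real.pi * (‖q θ‖ * ‖p θ‖) := by gcongr
      _ ≤ _ := by nlinarith [Real.pi_pos]
  rw [h1, intervalIntegral.integral_const_mul, intervalIntegral.integral_add
    (Continuous.intervalIntegrable (by fun_prop) _ _)
    (Continuous.intervalIntegrable (by fun_prop) _ _), integral_norm_sq_trigPoly,
    integral_norm_sq_trigPoly, norm_mul] at h2
  have e3 : ‖2 * (Real.pi : ℂ) * Complex.I‖ = 2 * Real.pi := by
    simp [abs_of_pos Real.pi_pos]
  rw [e3] at h2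
  refine le_of_mul_le_mul_left ?_ Real.two_pi_pos
  linarith

/-- The truncated Hilbert matrix `1 / (j - k)` has norm at most `π`. -/
theorem sum_sq_hilbert_le {m : ℕ} (x : Fin m → ℂ) :
    ∑ j : Fin m, ‖∑ k : Fin m, (((j : ℕ) : ℂ) - ((k : ℕ) : ℂ))⁻¹ * x k‖ ^ 2
      ≤ Real.pi ^ 2 * ∑ k, ‖x k‖ ^ 2 := by
  set T : Fin m → ℂ := fun j => ∑ k : Fin m, (((j : ℕ) : ℂ) - ((k : ℕ) : ℂ))⁻¹ * x k with hT
  have hpi := Real.pi_pos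
  have h := norm_hilbert_form_le x (fun j => ((Real.pi⁻¹ : ℝ) : ℂ) * T j)
  have e1 : ∑ j : Fin m, ∑ k : Fin m, star (((Real.pi⁻¹ : ℝ) : ℂ) * T j) *
      ((((j : ℕ) : ℂ) - ((k : ℕ) : ℂ))⁻¹ * x k)
      = ((Real.pi⁻¹ * ∑ j, ‖T j‖ ^ 2 : ℝ) : ℂ) := by
    push_cast
    rw [mul_sum]
    refine sum_congr rfl fun j _ => ?_
    rw [← mul_sum, ← Complex.conj_mul', star_mul', Complex.star_def, map_inv₀,
      Complex.conj_ofReal, mul_assoc]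
  have e2 : ∑ j, ‖((Real.pi⁻¹ : ℝ) : ℂ) * T j‖ ^ 2 = (Real.pi ^ 2)⁻¹ * ∑ j, ‖T j‖ ^ 2 := by
    simp [mul_pow, mul_sum]
  have hnn : 0 ≤ ∑ j, ‖T j‖ ^ 2 := by positivity
  rw [e1, e2, Complex.norm_real, Real.norm_of_nonneg (by positivity)] at h
  generalize ∑ j, ‖T j‖ ^ 2 = s at *
  generalize ∑ k, ‖x k‖ ^ 2 = u at *
  have h' := mul_le_mul_of_nonneg_left h (by positivity : 0 ≤ 2 * Real.pi)
  have e3 : 2 * Real.pi * (Real.pi⁻¹ * s) = 2 * s := by field_simp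
  have e4 : 2 * Real.pi * (Real.pi / 2 * (u + (Real.pi ^ 2)⁻¹ * s)) = Real.pi ^ 2 * u + s := by
    field_simp
  linarith

theorem sum_sq_hilbert_tensor_le {m : ℕ} (x : Fin m × Fin m → ℂ) :
    ∑ p : Fin m × Fin m, ‖∑ q : Fin m × Fin m,
      ((((p.1 : ℕ) : ℂ) - ((q.1 : ℕ) : ℂ))⁻¹ * (((p.2 : ℕ) : ℂ) - ((q.2 : ℕ) : ℂ))⁻¹) * x q‖ ^ 2
      ≤ (Real.pi ^ 2) ^ 2 * ∑ q, ‖x q‖ ^ 2 := by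
  set g : Fin m → Fin m → ℂ := fun k j' =>
    ∑ k' : Fin m, (((j' : ℕ) : ℂ) - ((k' : ℕ) : ℂ))⁻¹ * x (k, k') with hg
  have h1 : ∀ k, ∑ j', ‖g k j'‖ ^ 2 ≤ Real.pi ^ 2 * ∑ k', ‖x (k, k')‖ ^ 2 := fun k =>
    sum_sq_hilbert_le fun k' => x (k, k')
  have h2 : ∀ j', ∑ j : Fin m, ‖∑ k : Fin m, (((j : ℕ) : ℂ) - ((k : ℕ) : ℂ))⁻¹ * g k j'‖ ^ 2
      ≤ Real.pi ^ 2 * ∑ k, ‖g k j'‖ ^ 2 := fun j' => sum_sq_hilbert_le fun k => g k j'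
  calc _ = ∑ j' : Fin m, ∑ j : Fin m,
        ‖∑ k : Fin m, (((j : ℕ) : ℂ) - ((k : ℕ) : ℂ))⁻¹ * g k j'‖ ^ 2 := by
        rw [Fintype.sum_prod_type_right]
        refine sum_congr rfl fun j' _ => sum_congr rfl fun j _ => ?_
        rw [Fintype.sum_prod_type]
        simp only [hg, mul_sum, mul_assoc]
    _ ≤ ∑ j' : Fin m, Real.pi ^ 2 * ∑ k, ‖g k j'‖ ^ 2 := sum_le_sum fun j' _ => h2 j'
    _ = Real.pi ^ 2 * ∑ k, ∑ j', ‖g k j'‖ ^ 2 := by rw [← mul_sum, sum_comm]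
    _ ≤ Real.pi ^ 2 * ∑ k, Real.pi ^ 2 * ∑ k', ‖x (k, k')‖ ^ 2 := by
        gcongr with k
        exact h1 k
    _ = _ := by rw [← mul_sum, Fintype.sum_prod_type]; ring

/-- The Schur test. -/
theorem sum_sq_le_of_row_col_sum_le {ι : Type*} [Fintype ι] (M : ι → ι → ℂ) (s : ι → ι → ℝ)
    (hs : ∀ p q, ‖M p q‖ ≤ s p q) {C : ℝ} (hrow : ∀ p, ∑ q, s p q ≤ C)
    (hcol : ∀ q, ∑ p, s p q ≤ C) (x : ι → ℂ) :
    ∑ p, ‖∑ q, M p q * x q‖ ^ 2 ≤ C ^ 2 * ∑ q, ‖x q‖ ^ 2 := by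
  have hs0 : ∀ p q, 0 ≤ s p q := fun p q => (norm_nonneg _).trans (hs p q)
  have h1 : ∀ p, ‖∑ q, M p q * x q‖ ^ 2 ≤ C * ∑ q, s p q * ‖x q‖ ^ 2 := by
    intro p
    have hle : ‖∑ q, M p q * x q‖ ≤ ∑ q, s p q * ‖x q‖ := by
      refine (norm_sum_le _ _).trans (sum_le_sum fun q _ => ?_)
      rw [norm_mul]
      exact mul_le_mul_of_nonneg_right (hs p q) (norm_nonneg _)
    calc _ ≤ (∑ q, s p q * ‖x q‖) ^ 2 := by gcongr
      _ ≤ (∑ q, s p q) * ∑ q, s p q * ‖x q‖ ^ 2 :=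
        sum_sq_le_sum_mul_sum_of_sq_le_mul _ (fun q _ => hs0 p q)
          (fun q _ => mul_nonneg (hs0 p q) (sq_nonneg _)) fun q _ => by
            rw [mul_pow]
            exact le_of_eq (by ring)
      _ ≤ _ := mul_le_mul_of_nonneg_right (hrow p)
        (sum_nonneg fun q _ => mul_nonneg (hs0 p q) (sq_nonneg _))
  calc _ ≤ ∑ p, C * ∑ q, s p q * ‖x q‖ ^ 2 := sum_le_sum fun p _ => h1 p
    _ = C * ∑ q, (∑ p, s p q) * ‖x q‖ ^ 2 := by
        rw [← mul_sum, sum_comm]; simp only [sum_mul]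
    _ ≤ C * ∑ q, C * ‖x q‖ ^ 2 := by
        rcases isEmpty_or_nonempty ι with h | ⟨⟨p⟩⟩
        · simp
        · have hC : 0 ≤ C := (sum_nonneg fun q _ => hs0 p q).trans (hrow p)
          gcongr with q
          exact hcol q
    _ = _ := by rw [← mul_sum]; ring

theorem sum_abs_sub_rpow_le {m : ℕ} (j : Fin m) :
    ∑ k : Fin m, |((j : ℕ) : ℝ) - ((k : ℕ) : ℝ)| ^ (-(3 / 2) : ℝ)
      ≤ ∑' z : ℤ, |(z : ℝ)| ^ (-(3 / 2) : ℝ) := by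
  have hsum := Real.summable_abs_int_rpow (b := 3 / 2) (by norm_num)
  have hinj : Function.Injective fun k : Fin m => ((j : ℕ) : ℤ) - ((k : ℕ) : ℤ) := by
    intro a b h
    have : ((j : ℕ) : ℤ) - ((a : ℕ) : ℤ) = ((j : ℕ) : ℤ) - ((b : ℕ) : ℤ) := h
    exact Fin.ext (by omega)
  have := hsum.sum_le_tsum (univ.image fun k : Fin m => ((j : ℕ) : ℤ) - ((k : ℕ) : ℤ))
    (fun _ _ => by positivity)
  rw [sum_image hinj.injOn] at this
  simpa using this

theorem norm_inv_mul_inv_mul_inv_le (a b : ℝ) :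
    ‖((a : ℂ)⁻¹ * (b : ℂ)⁻¹) * ((a : ℂ) + b * Complex.I)⁻¹‖
      ≤ |a| ^ (-(3 / 2) : ℝ) * |b| ^ (-(3 / 2) : ℝ) := by
  rcases eq_or_ne a 0 with rfl | ha
  · simp
  rcases eq_or_ne b 0 with rfl | hb
  · simp
  have hE : ∀ c : ℝ, c ≠ 0 → |c| ^ (-(3 / 2) : ℝ) = |c|⁻¹ * (√|c|)⁻¹ := by
    intro c hc
    have hc' : 0 < |c| := abs_pos.2 hc
    rw [show (-(3 / 2) : ℝ) = -1 + -(1 / 2) by norm_num, Real.rpow_add hc', Real.rpow_neg_one,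
      Real.rpow_neg hc'.le, Real.sqrt_eq_rpow]
  have hz : √|a| * √|b| ≤ ‖(a : ℂ) + b * Complex.I‖ := by
    rw [Complex.norm_add_mul_I, ← Real.sqrt_mul (abs_nonneg a)]
    apply Real.sqrt_le_sqrt
    nlinarith [sq_abs a, sq_abs b, sq_nonneg (|a| - |b|), abs_nonneg a, abs_nonneg b]
  have ha' : 0 < √|a| := Real.sqrt_pos.2 (abs_pos.2 ha)
  have hb' : 0 < √|b| := Real.sqrt_pos.2 (abs_pos.2 hb)
  rw [hE a ha, hE b hb, norm_mul, norm_mul, norm_inv, norm_inv, norm_inv, Complex.norm_real,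
    Complex.norm_real, Real.norm_eq_abs, Real.norm_eq_abs]
  calc |a|⁻¹ * |b|⁻¹ * ‖(a : ℂ) + b * Complex.I‖⁻¹ ≤ |a|⁻¹ * |b|⁻¹ * (√|a| * √|b|)⁻¹ := by gcongr
    _ = _ := by rw [mul_inv]; ring

theorem im_star_mul_kernel (a b : ℝ) :
    (star ((a : ℂ) + b * Complex.I) *
      (((a : ℂ)⁻¹ * (b : ℂ)⁻¹) * ((a : ℂ) + b * Complex.I)⁻¹)).im
      = -(if a = 0 ∨ b = 0 then 0 else 2 / (a ^ 2 + b ^ 2)) := by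
  split_ifs with h
  · rcases h with rfl | rfl <;> simp
  · push Not at h
    have hn : a ^ 2 + b ^ 2 ≠ 0 := by have := sq_pos_of_ne_zero h.1; positivity
    have hz : (a : ℂ) + b * Complex.I ≠ 0 := fun h0 => h.1 (by simpa using congrArg Complex.re h0)
    have e : star ((a : ℂ) + b * Complex.I) *
      (((a : ℂ)⁻¹ * (b : ℂ)⁻¹) * ((a : ℂ) + b * Complex.I)⁻¹)
      = ((a⁻¹ * b⁻¹ * (a ^ 2 + b ^ 2)⁻¹ : ℝ) : ℂ) *
        ((a ^ 2 - b ^ 2 : ℝ) - (2 * a * b : ℝ) * Complex.I) := by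
      have hn' : (a : ℂ) ^ 2 + b ^ 2 ≠ 0 := by exact_mod_cast hn
      have ha : (a : ℂ) ≠ 0 := by exact_mod_cast h.1
      have hb : (b : ℂ) ≠ 0 := by exact_mod_cast h.2
      have : star ((a : ℂ) + b * Complex.I) = a - b * Complex.I := by
        simp [sub_eq_add_neg]
      rw [this]
      push_cast
      field_simp
      linear_combination (2 * (a : ℂ) * b ^ 2) * Complex.I_sq
    have ha := h.1
    have hb := h.2
    rw [e, Complex.im_ofReal_mul, Complex.sub_im, Complex.ofReal_im, Complex.im_ofReal_mul,
      Complex.I_im]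
    field_simp
    ring

theorem log_le_sum_inv_sq_add_sq (n : ℕ) :
    Real.log (n + 1) / 2
      ≤ ∑ a ∈ range n, ∑ b ∈ range n, 1 / (((a : ℝ) + 1) ^ 2 + ((b : ℝ) + 1) ^ 2) := by
  have h := log_add_one_le_harmonic n
  rw [harmonic] at h
  push_cast at h
  calc _ ≤ (∑ a ∈ range n, ((a : ℝ) + 1)⁻¹) / 2 := by gcongr
    _ = ∑ a ∈ range n, ∑ b ∈ range (a + 1), 1 / (2 * ((a : ℝ) + 1) ^ 2) := by
        rw [sum_div]
        refine sum_congr rfl fun a _ => ?_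
        rw [sum_const, card_range, nsmul_eq_mul]
        push_cast
        field_simp
    _ ≤ ∑ a ∈ range n, ∑ b ∈ range (a + 1), 1 / (((a : ℝ) + 1) ^ 2 + ((b : ℝ) + 1) ^ 2) := by
        refine sum_le_sum fun a _ => sum_le_sum fun b hb => ?_
        have hb' : (b : ℝ) ≤ a := by exact_mod_cast Nat.lt_succ_iff.1 (mem_range.1 hb)
        gcongr
        nlinarith
    _ ≤ _ := by
        refine sum_le_sum fun a ha => sum_le_sum_of_subset_of_nonneg ?_ fun _ _ _ => by positivity
        exact range_subset_range.2 (mem_range.1 ha)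

theorem sum_shift_le_sum_fin {n k : ℕ} (hk : k < n) (f : ℝ → ℝ) (hf : ∀ y, 0 ≤ f y) :
    ∑ a ∈ range n, f ((a : ℝ) + 1) ≤ ∑ j : Fin (2 * n), f (((j : ℕ) : ℝ) - (k : ℝ)) := by
  rw [Fin.sum_univ_eq_sum_range (fun j => f ((j : ℝ) - k))]
  have h := sum_Ico_eq_sum_range (fun j : ℕ => f ((j : ℝ) - k)) (k + 1) (k + 1 + n)
  rw [Nat.add_sub_cancel_left] at h
  calc _ = ∑ j ∈ Ico (k + 1) (k + 1 + n), f ((j : ℝ) - k) := by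
        rw [h]
        refine sum_congr rfl fun a _ => ?_
        congr 1
        push_cast
        ring
    _ ≤ _ := sum_le_sum_of_subset_of_nonneg
        (fun j hj => by rw [mem_Ico] at hj; rw [mem_range]; omega) fun _ _ _ => hf _

theorem sq_mul_log_le_sum {n : ℕ} :
    (n : ℝ) ^ 2 * Real.log (n + 1) ≤ ∑ q : Fin (2 * n) × Fin (2 * n),
      ∑ p : Fin (2 * n) × Fin (2 * n),
        (if ((p.1 : ℕ) : ℝ) - ((q.1 : ℕ) : ℝ) = 0 ∨ ((p.2 : ℕ) : ℝ) - ((q.2 : ℕ) : ℝ) = 0 then 0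
          else 2 / ((((p.1 : ℕ) : ℝ) - ((q.1 : ℕ) : ℝ)) ^ 2
            + (((p.2 : ℕ) : ℝ) - ((q.2 : ℕ) : ℝ)) ^ 2)) := by
  set f : ℝ → ℝ → ℝ := fun a b => if a = 0 ∨ b = 0 then 0 else 2 / (a ^ 2 + b ^ 2) with hf
  have hf0 : ∀ a b, 0 ≤ f a b := fun a b => by simp only [hf]; split_ifs <;> positivity
  set F : ℕ → ℕ → ℝ := fun k k' => ∑ p : Fin (2 * n) × Fin (2 * n),
    f (((p.1 : ℕ) : ℝ) - (k : ℝ)) (((p.2 : ℕ) : ℝ) - (k' : ℝ)) with hF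
  have hF0 : ∀ k k', 0 ≤ F k k' := fun k k' => sum_nonneg fun _ _ => hf0 _ _
  have hlow : ∀ k < n, ∀ k' < n, Real.log (n + 1) ≤ F k k' := by
    intro k hk k' hk'
    have h1 := log_le_sum_inv_sq_add_sq n
    calc Real.log (n + 1) ≤ ∑ a ∈ range n, ∑ b ∈ range n, f ((a : ℝ) + 1) ((b : ℝ) + 1) := by
          have : ∑ a ∈ range n, ∑ b ∈ range n, f ((a : ℝ) + 1) ((b : ℝ) + 1)
              = 2 * ∑ a ∈ range n, ∑ b ∈ range n,
                1 / (((a : ℝ) + 1) ^ 2 + ((b : ℝ) + 1) ^ 2) := by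
            simp only [mul_sum]
            refine sum_congr rfl fun a _ => sum_congr rfl fun b _ => ?_
            rw [hf]
            simp only
            have ha := a.cast_nonneg (α := ℝ)
            have hb := b.cast_nonneg (α := ℝ)
            rw [if_neg (by rintro (h | h) <;> linarith)]
            ring
          linarith
      _ ≤ ∑ a ∈ range n, ∑ j' : Fin (2 * n), f ((a : ℝ) + 1) (((j' : ℕ) : ℝ) - (k' : ℝ)) :=
          sum_le_sum fun a _ => sum_shift_le_sum_fin hk' _ fun _ => hf0 _ _
      _ ≤ ∑ j : Fin (2 * n), ∑ j' : Fin (2 * n),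
            f (((j : ℕ) : ℝ) - (k : ℝ)) (((j' : ℕ) : ℝ) - (k' : ℝ)) :=
          sum_shift_le_sum_fin hk
            (fun y => ∑ j' : Fin (2 * n), f y (((j' : ℕ) : ℝ) - (k' : ℝ)))
            fun _ => sum_nonneg fun _ _ => hf0 _ _
      _ = F k k' := by rw [hF]; simp only [Fintype.sum_prod_type]
  have hsub : range n ⊆ range (2 * n) := range_subset_range.2 (by omega)
  calc (n : ℝ) ^ 2 * Real.log (n + 1)
      = ∑ k ∈ range n, ∑ k' ∈ range n, Real.log (n + 1) := by simp; ring
    _ ≤ ∑ k ∈ range n, ∑ k' ∈ range n, F k k' := sum_le_sum fun k hk => sum_le_sum fun k' hk' =>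
        hlow k (mem_range.1 hk) k' (mem_range.1 hk')
    _ ≤ ∑ k ∈ range n, ∑ k' ∈ range (2 * n), F k k' := sum_le_sum fun k _ =>
        sum_le_sum_of_subset_of_nonneg hsub fun _ _ _ => hF0 _ _
    _ ≤ ∑ k ∈ range (2 * n), ∑ k' ∈ range (2 * n), F k k' :=
        sum_le_sum_of_subset_of_nonneg hsub fun _ _ _ => sum_nonneg fun _ _ => hF0 _ _
    _ = ∑ k : Fin (2 * n), ∑ k' : Fin (2 * n), F k k' := by
        rw [← Fin.sum_univ_eq_sum_range (fun k => ∑ k' ∈ range (2 * n), F k k')]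
        simp only [← Fin.sum_univ_eq_sum_range]
    _ = _ := by rw [Fintype.sum_prod_type]

theorem norm_sum_entries_le {ι : Type*} [Fintype ι] [DecidableEq ι] (M : Matrix ι ι ℂ) :
    ‖∑ q, ∑ p, M p q‖ ≤ ‖Matrix.toEuclideanCLM (n := ι) (𝕜 := ℂ) M‖ * Fintype.card ι := by
  set v : EuclideanSpace ℂ ι := WithLp.toLp 2 fun _ => 1 with hv
  have hvn : ‖v‖ ^ 2 = Fintype.card ι := by
    rw [EuclideanSpace.norm_sq_eq]; simp [hv]
  have h : inner ℂ v (Matrix.toEuclideanCLM (n := ι) (𝕜 := ℂ) M v) = ∑ q, ∑ p, M p q := by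
    rw [hv, Matrix.toEuclideanCLM_toLp, sum_comm]
    simp [PiLp.inner_apply, Matrix.mulVec, dotProduct]
  rw [← h, ← hvn]
  calc _ ≤ ‖v‖ * ‖Matrix.toEuclideanCLM (n := ι) (𝕜 := ℂ) M v‖ := norm_inner_le_norm _ _
    _ ≤ ‖v‖ * (‖Matrix.toEuclideanCLM (n := ι) (𝕜 := ℂ) M‖ * ‖v‖) := by
        gcongr
        exact ContinuousLinearMap.le_opNorm _ _
    _ = _ := by ring

theorem exists_large_star_commutator :
    ∃ C₁ > (0 : ℝ), ∀ δ r : ℝ, 0 < δ → δ ≤ r →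
      ∃ (H : Type) (_ : NormedAddCommGroup H) (_ : InnerProductSpace ℂ H)
        (_ : CompleteSpace H) (_ : TopologicalSpace.SeparableSpace H) (N R : H →L[ℂ] H),
        IsStarNormal N ∧ spectrum ℂ N ⊆ Metric.closedBall 0 r ∧ ‖R‖ ≤ 1 ∧
        ‖N * R - R * N‖ ≤ δ ∧
        C₁ * (δ * Real.log (2 * r / δ)) ≤ ‖star N * R - R * star N‖ := by
  set S : ℝ := ∑' z : ℤ, |(z : ℝ)| ^ (-(3 / 2) : ℝ) with hS
  have hS0 : 0 ≤ S := tsum_nonneg fun _ => by positivity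
  set C : ℝ := Real.pi ^ 2 + S ^ 2 with hC
  have hpi := Real.pi_pos
  have hC0 : 0 < C := by positivity
  refine ⟨1 / (32 * C), by positivity, fun δ r hδ hδr => ?_⟩
  have hr : 0 < r := hδ.trans_le hδr
  set n : ℕ := ⌊r / δ⌋₊ with hn
  have hn1 : 1 ≤ n := Nat.le_floor (by rw [Nat.cast_one, le_div_iff₀ hδ]; linarith)
  have hn1' : (1 : ℝ) ≤ n := by exact_mod_cast hn1
  have hnr : n * δ ≤ r := by
    rw [← le_div_iff₀ hδ]; exact Nat.floor_le (by positivity)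
  have hrn : r / δ < n + 1 := Nat.lt_floor_add_one _
  let ι := Fin (2 * n) × Fin (2 * n)
  have : Nonempty ι := ⟨(⟨0, by omega⟩, ⟨0, by omega⟩)⟩
  let pos : ι → ℂ := fun p => ((p.1 : ℕ) : ℂ) + ((p.2 : ℕ) : ℂ) * Complex.I
  let t : ι → ι → ℂ := fun p q =>
    (((p.1 : ℕ) : ℂ) - ((q.1 : ℕ) : ℂ))⁻¹ * (((p.2 : ℕ) : ℂ) - ((q.2 : ℕ) : ℂ))⁻¹
  let a : ι → ι → ℂ := fun p q => t p q * (pos p - pos q)⁻¹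
  let D : Matrix ι ι ℂ := Matrix.diagonal fun p => ((δ / 4 : ℝ) : ℂ) * pos p
  let B : Matrix ι ι ℂ := Matrix.of fun p q => ((C⁻¹ : ℝ) : ℂ) * a p q
  have hpos : ∀ p q : ι, pos p - pos q = ((((p.1 : ℕ) : ℝ) - ((q.1 : ℕ) : ℝ) : ℝ) : ℂ)
      + ((((p.2 : ℕ) : ℝ) - ((q.2 : ℕ) : ℝ) : ℝ) : ℂ) * Complex.I := fun p q => by
    simp only [pos]; push_cast; ring
  have ht : ∀ p q : ι, t p q = ((((p.1 : ℕ) : ℝ) - ((q.1 : ℕ) : ℝ) : ℝ) : ℂ)⁻¹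
      * ((((p.2 : ℕ) : ℝ) - ((q.2 : ℕ) : ℝ) : ℝ) : ℂ)⁻¹ := fun p q => by
    simp only [t]; push_cast; rfl
  have hmul : ∀ p q : ι, (pos p - pos q) * a p q = t p q := by
    intro p q
    by_cases h : pos p - pos q = 0
    · have h1 : ((p.1 : ℕ) : ℝ) - ((q.1 : ℕ) : ℝ) = 0 := by
        simpa using congrArg Complex.re ((hpos p q).symm.trans h)
      rw [h, ht, h1]
      simp
    · simp only [a]
      field_simp
  have hBnorm : ‖Matrix.toEuclideanCLM (n := ι) (𝕜 := ℂ) B‖ ≤ 1 := by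
    refine norm_toEuclideanCLM_le _ zero_le_one fun x => ?_
    let s : ι → ι → ℝ := fun p q => C⁻¹ *
      (|((p.1 : ℕ) : ℝ) - ((q.1 : ℕ) : ℝ)| ^ (-(3 / 2) : ℝ)
        * |((p.2 : ℕ) : ℝ) - ((q.2 : ℕ) : ℝ)| ^ (-(3 / 2) : ℝ))
    have hrow : ∀ p, ∑ q, s p q ≤ 1 := by
      intro p
      simp only [s]
      rw [← mul_sum, Fintype.sum_prod_type]
      dsimp only
      rw [← sum_mul_sum]
      calc _ ≤ C⁻¹ * (S * S) := by
            gcongr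
            · exact sum_abs_sub_rpow_le p.1
            · exact sum_abs_sub_rpow_le p.2
        _ ≤ C⁻¹ * C := by gcongr; nlinarith
        _ = 1 := inv_mul_cancel₀ hC0.ne'
    refine sum_sq_le_of_row_col_sum_le (fun p q => B p q) s (fun p q => ?_) hrow (fun q => ?_) x
    · simp only [B, Matrix.of_apply, s]
      rw [norm_mul, Complex.norm_real, Real.norm_of_nonneg (by positivity)]
      gcongr
      simp only [a]
      rw [ht, hpos]
      exact norm_inv_mul_inv_mul_inv_le _ _
    · refine le_of_eq_of_le (sum_congr rfl fun p _ => ?_) (hrow q)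
      simp only [s]
      rw [abs_sub_comm, abs_sub_comm ((p.2 : ℕ) : ℝ)]
  have hcomm : ∀ p q, (D * B - B * D) p q = ((δ / (4 * C) : ℝ) : ℂ) * t p q := by
    intro p q
    rw [Matrix.sub_apply, Matrix.diagonal_mul, Matrix.mul_diagonal, ← hmul]
    simp only [B, Matrix.of_apply]
    push_cast
    field_simp
  have hstar : ∀ p q, (star D * B - B * star D) p q
      = ((δ / (4 * C) : ℝ) : ℂ) * (star (pos p - pos q) * a p q) := by
    intro p q
    rw [Matrix.star_eq_conjTranspose, Matrix.diagonal_conjTranspose, Matrix.sub_apply,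
      Matrix.diagonal_mul, Matrix.mul_diagonal]
    simp only [B, Matrix.of_apply, Pi.star_apply, star_mul', star_sub, Complex.star_def,
      Complex.conj_ofReal]
    push_cast
    field_simp
  have hDnorm : ‖Matrix.toEuclideanCLM (n := ι) (𝕜 := ℂ) D‖ ≤ r := by
    refine norm_toEuclideanCLM_le _ hr.le fun x => ?_
    rw [mul_sum]
    refine sum_le_sum fun p _ => ?_
    have e : ∑ q, D p q * x q = ((δ / 4 : ℝ) : ℂ) * pos p * x p :=
      Matrix.mulVec_diagonal _ x p
    have hp1 : ((p.1 : ℕ) : ℝ) ≤ 2 * n := by exact_mod_cast p.1.2.le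
    have hp2 : ((p.2 : ℕ) : ℝ) ≤ 2 * n := by exact_mod_cast p.2.2.le
    have hpn : ‖pos p‖ ≤ 4 * n := by
      refine (norm_add_le _ _).trans ?_
      rw [norm_mul, Complex.norm_I, Complex.norm_natCast, Complex.norm_natCast]
      linarith
    rw [e, norm_mul, mul_pow]
    gcongr
    rw [norm_mul, Complex.norm_real, Real.norm_of_nonneg (by positivity)]
    calc δ / 4 * ‖pos p‖ ≤ δ / 4 * (4 * n) := by gcongr
      _ ≤ r := by linarith
  refine ⟨EuclideanSpace ℂ ι, inferInstance, inferInstance, inferInstance, inferInstance,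
    Matrix.toEuclideanCLM (n := ι) (𝕜 := ℂ) D, Matrix.toEuclideanCLM (n := ι) (𝕜 := ℂ) B,
    ⟨?_⟩, ?_, hBnorm, ?_, ?_⟩
  · rw [← map_star, Commute, SemiconjBy, ← map_mul, ← map_mul, Matrix.star_eq_conjTranspose,
      Matrix.diagonal_conjTranspose, Matrix.diagonal_mul_diagonal, Matrix.diagonal_mul_diagonal]
    simp only [mul_comm]
  · exact (spectrum.subset_closedBall_norm _).trans (Metric.closedBall_subset_closedBall hDnorm)
  · rw [← map_mul, ← map_mul, ← map_sub]
    refine norm_toEuclideanCLM_le _ hδ.le fun x => ?_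
    simp only [hcomm, mul_assoc, ← mul_sum, norm_mul, mul_pow]
    have h := sum_sq_hilbert_tensor_le x
    rw [Complex.norm_real, Real.norm_of_nonneg (by positivity)]
    simp only [t, mul_assoc] at h ⊢
    calc _ ≤ (δ / (4 * C)) ^ 2 * ((Real.pi ^ 2) ^ 2 * ∑ q, ‖x q‖ ^ 2) := by gcongr
      _ = (δ / (4 * C) * Real.pi ^ 2) ^ 2 * ∑ q, ‖x q‖ ^ 2 := by ring
      _ ≤ δ ^ 2 * ∑ q, ‖x q‖ ^ 2 := by
        gcongr
        rw [div_mul_eq_mul_div, div_le_iff₀ (by positivity)]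
        gcongr
        nlinarith [sq_nonneg S, sq_nonneg Real.pi]
  · rw [← map_star, ← map_mul, ← map_mul, ← map_sub]
    have h1 := norm_sum_entries_le (star D * B - B * star D)
    set X := ‖Matrix.toEuclideanCLM (n := ι) (𝕜 := ℂ) (star D * B - B * star D)‖
    have h2 : (∑ q, ∑ p, (star D * B - B * star D) p q).im ≤ -(δ / (4 * C) *
        ((n : ℝ) ^ 2 * Real.log (n + 1))) := by
      rw [Complex.im_sum]
      simp only [Complex.im_sum, hstar, Complex.im_ofReal_mul, a]
      simp only [hpos, ht, im_star_mul_kernel]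
      simp only [mul_neg, sum_neg_distrib, ← mul_sum]
      rw [neg_le_neg_iff]
      gcongr
      exact sq_mul_log_le_sum
    have h3 := (neg_le_abs _).trans (Complex.abs_im_le_norm
      (∑ q, ∑ p, (star D * B - B * star D) p q))
    have hcard : (Fintype.card ι : ℝ) = 4 * n ^ 2 := by
      simp only [ι, Fintype.card_prod, Fintype.card_fin]; push_cast; ring
    rw [hcard] at h1
    have h4 : δ / (4 * C) * Real.log (n + 1) ≤ 4 * X := by
      have hn2 : (0 : ℝ) < (n : ℝ) ^ 2 := by positivity
      refine le_of_mul_le_mul_left ?_ hn2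
      linarith
    have h5 : Real.log (2 * r / δ) ≤ 2 * Real.log (n + 1) := by
      have : 2 * Real.log (n + 1) = Real.log (((n : ℝ) + 1) ^ 2) := by
        rw [Real.log_pow]; norm_num
      rw [this]
      refine Real.log_le_log (by positivity) ?_
      rw [mul_div_assoc]
      nlinarith only [hrn, hn1']
    calc 1 / (32 * C) * (δ * Real.log (2 * r / δ))
        ≤ 1 / (32 * C) * (δ * (2 * Real.log (n + 1))) := by gcongr
      _ = δ / (4 * C) * Real.log (n + 1) / 4 := by field_simp; ring
      _ ≤ X := by linarith

end LatticeExample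

/-- Theorem 6.1: `C₁ δ log(2r/δ) ≤ Ω^C_{z̄, clos(r𝔻)}(δ) ≤ C₂ δ log(2r/δ)`. Upper bound: for
every normal `N` of norm at most `r` and every contraction `R` with `‖NR - RN‖ ≤ δ` one has
`‖N*R - RN*‖ ≤ C₂ δ log(2r/δ)`; lower bound: such `N`, `R` exist (on a separable Hilbert
space, with spectrum of `N` in the closed disk of radius `r`) with
`‖N*R - RN*‖ ≥ C₁ δ log(2r/δ)`. -/
theorem stmt_15 :
    ∃ C₁ > (0 : ℝ), ∃ C₂ > (0 : ℝ), ∀ δ r : ℝ, 0 < δ → δ ≤ r →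
      ((∀ (H : Type) [NormedAddCommGroup H] [InnerProductSpace ℂ H] [CompleteSpace H]
          (N R : H →L[ℂ] H), IsStarNormal N → ‖N‖ ≤ r → ‖R‖ ≤ 1 →
          ‖N * R - R * N‖ ≤ δ →
          ‖star N * R - R * star N‖ ≤ C₂ * (δ * Real.log (2 * r / δ)))
        ∧
        (∃ (H : Type) (_ : NormedAddCommGroup H) (_ : InnerProductSpace ℂ H)
          (_ : CompleteSpace H) (_ : TopologicalSpace.SeparableSpace H)
          (N R : H →L[ℂ] H),
          IsStarNormal N ∧ spectrum ℂ N ⊆ Metric.closedBall 0 r ∧ ‖R‖ ≤ 1 ∧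
          ‖N * R - R * N‖ ≤ δ ∧
          C₁ * (δ * Real.log (2 * r / δ)) ≤ ‖star N * R - R * star N‖)) := by
  obtain ⟨C₁, hC₁, hlow⟩ := exists_large_star_commutator
  refine ⟨C₁, hC₁, 20, by norm_num, fun δ r hδ hδr => ⟨?_, hlow δ r hδ hδr⟩⟩
  intro H _ _ _ N R hN hNr hR h
  exact norm_star_commutator_le hN hδ hδr hNr hR h
end

section
/- There is a constant C > 0 such that for all bounded normal operators N₁, N₂ on a complex Hilbert space H and every bounded operator R on H with ‖R‖ ≤ 1 and RN₁ − N₂R ≠ 0, one has ‖RN₁* − N₂*R‖ ≤ C·log( 2(‖N₁‖ + ‖N₂‖) / ‖RN₁ − N₂R‖ )·‖RN₁ − N₂R‖. -/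
open Complex

noncomputable section

/-- The real-linear map `h ↦ h • p + conj h • q`, i.e. the real differential with Wirtinger
derivatives `p` and `q`. -/
def wirtingerCLM {E : Type*} [NormedAddCommGroup E] [NormedSpace ℂ E] (p q : E) : ℂ →L[ℝ] E :=
  ContinuousLinearMap.smulRight (ContinuousLinearMap.id ℝ ℂ) p +
    ContinuousLinearMap.smulRight (conjCLE : ℂ →L[ℝ] ℂ) q

@[simp]
lemma wirtingerCLM_apply {E : Type*} [NormedAddCommGroup E] [NormedSpace ℂ E] (p q : E) (h : ℂ) :
    wirtingerCLM p q h = h • p + (starRingEnd ℂ) h • q := by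
  simp [wirtingerCLM]

lemma integral_exp_neg_ofReal_add_mul_I (s : ℝ) :
    ∫ y : ℝ in (0 : ℝ)..2 * Real.pi, exp (-(s + y * I)) = 0 := by
  have h : ∀ y : ℝ, exp (-(s + y * I)) = exp (-s) * exp ((-I) * y) := fun y => by
    rw [← Complex.exp_add]; ring_nf
  simp_rw [h, intervalIntegral.integral_const_mul]
  rw [integral_exp_mul_complex (by simp)]
  have : exp (-I * ((2 * Real.pi : ℝ) : ℂ)) = 1 := by
    rw [Complex.exp_eq_one_iff]; exact ⟨-1, by push_cast; ring⟩
  rw [this]; simp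

lemma integral_exp_neg_mul_conj_exp (s : ℝ) :
    ∫ y : ℝ in (0 : ℝ)..2 * Real.pi,
      exp (-(s + y * I)) * (starRingEnd ℂ) (exp (s + y * I)) = 0 := by
  have h : ∀ y : ℝ, exp (-(s + y * I)) * (starRingEnd ℂ) (exp (s + y * I))
      = exp ((-2 * I) * y) := fun y => by
    rw [← Complex.exp_conj, ← Complex.exp_add]
    simp only [map_add, map_mul, conj_ofReal, conj_I]; ring_nf
  simp_rw [h]
  rw [integral_exp_mul_complex (by simp)]
  have : exp (-2 * I * ((2 * Real.pi : ℝ) : ℂ)) = 1 := by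
    rw [Complex.exp_eq_one_iff]; exact ⟨-2, by push_cast; ring⟩
  rw [this]; simp

section Wirtinger

variable {E : Type*} [NormedAddCommGroup E] [NormedSpace ℂ E] {u P Q : ℂ → E} {δ K : ℝ}

lemma hasFDerivAt_exp_neg_smul_comp_exp
    (hu : ∀ z, HasFDerivAt u (wirtingerCLM (P z) (Q z)) z) (w : ℂ) :
    HasFDerivAt (fun w => exp (-w) • u (exp w))
      (wirtingerCLM (P (exp w) - exp (-w) • u (exp w))
        ((exp (-w) * (starRingEnd ℂ) (exp w)) • Q (exp w))) w := by
  have h1 : HasFDerivAt (fun w : ℂ => exp (-w))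
      ((ContinuousLinearMap.toSpanSingleton ℂ (exp (-w) * -1)).restrictScalars ℝ) w :=
    ((hasDerivAt_neg w).cexp.hasFDerivAt).restrictScalars ℝ
  have h2 : HasFDerivAt (fun w : ℂ => exp w)
      ((ContinuousLinearMap.toSpanSingleton ℂ (exp w)).restrictScalars ℝ) w :=
    (Complex.hasDerivAt_exp w).hasFDerivAt.restrictScalars ℝ
  have h3 := h1.smul ((hu (exp w)).comp w h2)
  refine h3.congr_fderiv ?_
  have he : exp (-w) * exp w = 1 := by rw [← Complex.exp_add]; simp
  ext k
  have hk : exp (-w) * (k * exp w) = k := by linear_combination k * he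
  simp [smul_smul, hk]
  module

/-- Comparison of the first Fourier coefficients of `u` on two circles. -/
lemma norm_integral_exp_neg_smul_sub_le [CompleteSpace E]
    (hu : ∀ z, HasFDerivAt u (wirtingerCLM (P z) (Q z)) z)
    (hQc : Continuous Q) (hQ : ∀ z, ‖Q z‖ ≤ δ) {s t : ℝ} (hst : s ≤ t) :
    ‖(∫ y : ℝ in (0 : ℝ)..2 * Real.pi, exp (-(t + y * I)) • u (exp (t + y * I))) -
      ∫ y : ℝ in (0 : ℝ)..2 * Real.pi, exp (-(s + y * I)) • u (exp (s + y * I))‖ ≤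
      2 * Real.pi * (2 * δ * (t - s)) := by
  have hderiv := hasFDerivAt_exp_neg_smul_comp_exp hu
  have huc : Continuous u := continuous_iff_continuousAt.2 fun z => (hu z).continuousAt
  have key : ∀ w : ℂ, I • (wirtingerCLM (P (exp w) - exp (-w) • u (exp w))
        ((exp (-w) * (starRingEnd ℂ) (exp w)) • Q (exp w))) 1 -
      (wirtingerCLM (P (exp w) - exp (-w) • u (exp w))
        ((exp (-w) * (starRingEnd ℂ) (exp w)) • Q (exp w))) I =
      (2 * I * (exp (-w) * (starRingEnd ℂ) (exp w))) • Q (exp w) := fun w => by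
    simp only [wirtingerCLM_apply, map_one, conj_I]; module
  have hG := integral_boundary_rect_of_hasFDerivAt_real_off_countable
    (fun w => exp (-w) • u (exp w)) _ (s : ℂ) (t + (2 * Real.pi : ℝ) * I) ∅
    Set.countable_empty (by fun_prop) (fun w _ => hderiv w) (by
      simp_rw [key]
      refine ContinuousOn.integrableOn_compact (isCompact_uIcc.reProdIm isCompact_uIcc) ?_
      have : Continuous fun w : ℂ =>
        (2 * I * (exp (-w) * (starRingEnd ℂ) (exp w))) • Q (exp w) := by fun_prop
      exact this.continuousOn)
  simp_rw [key] at hG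
  have hper : ∀ x : ℝ, exp (x + ((2 * Real.pi : ℝ) : ℂ) * I) = exp x := fun x => by
    push_cast; exact Complex.exp_periodic _
  have hper' : ∀ x : ℝ, exp (-(x + ((2 * Real.pi : ℝ) : ℂ) * I)) = exp (-x) := fun x => by
    rw [Complex.exp_neg, hper, Complex.exp_neg]
  have e1 : (s : ℂ).re = s := by simp
  have e2 : (s : ℂ).im = 0 := by simp
  have e3 : ((t : ℂ) + (2 * Real.pi : ℝ) * I).re = t := by simp
  have e4 : ((t : ℂ) + (2 * Real.pi : ℝ) * I).im = 2 * Real.pi := by simp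
  rw [e1, e2, e3, e4] at hG
  simp only [hper, hper', ofReal_zero, zero_mul, add_zero, sub_self, zero_add] at hG
  rw [← smul_sub] at hG
  have hbound : ‖∫ x : ℝ in s..t, ∫ y : ℝ in (0 : ℝ)..2 * Real.pi,
      (2 * I * (exp (-(x + y * I)) * (starRingEnd ℂ) (exp (x + y * I)))) • Q (exp (x + y * I))‖
      ≤ (2 * δ * |2 * Real.pi - 0|) * |t - s| := by
    refine intervalIntegral.norm_integral_le_of_norm_le_const fun x _ => ?_
    refine intervalIntegral.norm_integral_le_of_norm_le_const fun y _ => ?_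
    have : ‖2 * I * (exp (-(x + y * I)) * (starRingEnd ℂ) (exp (x + y * I)))‖ = 2 := by
      rw [norm_mul, norm_mul, norm_mul, RCLike.norm_conj, ← norm_mul (exp _), ← Complex.exp_add]
      simp
    rw [norm_smul, this]
    exact mul_le_mul_of_nonneg_left (hQ _) zero_le_two
  rw [← hG, norm_smul, norm_I, one_mul, sub_zero, abs_of_pos Real.two_pi_pos,
    abs_of_nonneg (sub_nonneg.2 hst)] at hbound
  linarith

/-- A quantitative Liouville theorem: a bounded function with small `∂̄`-derivative has a small
`∂`-derivative at the origin, up to a logarithm. -/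
lemma norm_wirtinger_le [CompleteSpace E]
    (hu : ∀ z, HasFDerivAt u (wirtingerCLM (P z) (Q z)) z)
    (hu1 : ∀ z, ‖u z‖ ≤ 1) (hQc : Continuous Q) (hQ : ∀ z, ‖Q z‖ ≤ δ)
    (htaylor : ∀ z, ‖u z - u 0 - wirtingerCLM (P 0) (Q 0) z‖ ≤ K * ‖z‖ ^ 2)
    {s t : ℝ} (hst : s ≤ t) :
    ‖P 0‖ ≤ Real.exp (-t) + 2 * δ * (t - s) + K * Real.exp s := by
  have huc : Continuous u := continuous_iff_continuousAt.2 fun z => (hu z).continuousAt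
  have h1 := norm_integral_exp_neg_smul_sub_le hu hQc hQ hst
  have h2 : ‖∫ y : ℝ in (0 : ℝ)..2 * Real.pi, exp (-(t + y * I)) • u (exp (t + y * I))‖
      ≤ Real.exp (-t) * |2 * Real.pi - 0| := by
    refine intervalIntegral.norm_integral_le_of_norm_le_const fun y _ => ?_
    rw [norm_smul, Complex.norm_exp]
    simpa using mul_le_mul_of_nonneg_left (hu1 (exp (t + y * I))) (Real.exp_pos (-t)).le
  have h3 : ‖∫ y : ℝ in (0 : ℝ)..2 * Real.pi,
      exp (-(s + y * I)) • (u (exp (s + y * I)) - u 0 - wirtingerCLM (P 0) (Q 0) (exp (s + y * I)))‖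
      ≤ K * Real.exp s * |2 * Real.pi - 0| := by
    refine intervalIntegral.norm_integral_le_of_norm_le_const fun y _ => ?_
    rw [norm_smul]
    calc _ ≤ ‖exp (-(s + y * I))‖ * (K * ‖exp (s + y * I)‖ ^ 2) := by gcongr; exact htaylor _
      _ = K * Real.exp s := by
        simp only [Complex.norm_exp]
        simp only [neg_add_rev, add_re, neg_re, mul_re, ofReal_re, I_re, mul_zero, ofReal_im, I_im,
          mul_one, sub_self, neg_zero, zero_add, add_zero]
        rw [Real.exp_neg]
        field_simp
  have h4 : (∫ y : ℝ in (0 : ℝ)..2 * Real.pi,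
      exp (-(s + y * I)) • (u (exp (s + y * I)) - u 0 - wirtingerCLM (P 0) (Q 0) (exp (s + y * I))))
      = (∫ y : ℝ in (0 : ℝ)..2 * Real.pi, exp (-(s + y * I)) • u (exp (s + y * I))) -
        (2 * Real.pi) • P 0 := by
    have e : ∀ y : ℝ, exp (-(s + y * I)) •
        (u (exp (s + y * I)) - u 0 - wirtingerCLM (P 0) (Q 0) (exp (s + y * I))) =
        exp (-(s + y * I)) • u (exp (s + y * I)) - exp (-(s + y * I)) • u 0 - P 0 -
          (exp (-(s + y * I)) * (starRingEnd ℂ) (exp (s + y * I))) • Q 0 := fun y => by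
      have : exp (-(s + y * I)) * exp (s + y * I) = 1 := by rw [← Complex.exp_add]; simp
      rw [wirtingerCLM_apply, smul_sub, smul_sub, smul_add, smul_smul, smul_smul, this, one_smul]
      abel
    simp_rw [e]
    have c1 : Continuous fun y : ℝ => exp (-(s + y * I)) • u (exp (s + y * I)) := by fun_prop
    have c2 : Continuous fun y : ℝ => exp (-(s + y * I)) • u 0 := by fun_prop
    have c3 : Continuous fun y : ℝ =>
      (exp (-(s + y * I)) * (starRingEnd ℂ) (exp (s + y * I))) • Q 0 := by fun_prop
    rw [intervalIntegral.integral_sub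
        (Continuous.intervalIntegrable (by fun_prop) _ _) (c3.intervalIntegrable _ _),
      intervalIntegral.integral_sub (Continuous.intervalIntegrable (by fun_prop) _ _)
        (continuous_const.intervalIntegrable _ _),
      intervalIntegral.integral_sub (c1.intervalIntegrable _ _) (c2.intervalIntegrable _ _),
      intervalIntegral.integral_smul_const, intervalIntegral.integral_smul_const,
      integral_exp_neg_ofReal_add_mul_I, integral_exp_neg_mul_conj_exp]
    simp
  rw [h4] at h3
  rw [sub_zero, abs_of_pos Real.two_pi_pos] at h2 h3
  set Gt := ∫ y : ℝ in (0 : ℝ)..2 * Real.pi, exp (-(t + y * I)) • u (exp (t + y * I))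
  set Gs := ∫ y : ℝ in (0 : ℝ)..2 * Real.pi, exp (-(s + y * I)) • u (exp (s + y * I))
  have h5 : ‖(2 * Real.pi) • P 0‖ ≤ ‖Gt‖ + ‖Gt - Gs‖ + ‖Gs - (2 * Real.pi) • P 0‖ := by
    have : (2 * Real.pi) • P 0 = Gt - (Gt - Gs) - (Gs - (2 * Real.pi) • P 0) := by abel
    calc _ = ‖Gt - (Gt - Gs) - (Gs - (2 * Real.pi) • P 0)‖ := by rw [← this]
      _ ≤ _ := (norm_sub_le _ _).trans (by gcongr; exact norm_sub_le _ _)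
  rw [norm_smul, Real.norm_of_nonneg Real.two_pi_pos.le] at h5
  refine le_of_mul_le_mul_left ?_ Real.two_pi_pos
  linarith

end Wirtinger

section Exponential

variable {A : Type*} [CStarAlgebra A]

/-- The unitary `exp (z a* - z̄ a)`. -/
def expWeyl (a : A) (z : ℂ) : A := NormedSpace.exp (wirtingerCLM (star a) (-a) z)

@[simp]
lemma expWeyl_zero (a : A) : expWeyl a 0 = 1 := by simp [expWeyl]

lemma norm_expWeyl_le (a : A) (z : ℂ) : ‖expWeyl a z‖ ≤ 1 := by
  have h : wirtingerCLM (star a) (-a) z ∈ skewAdjoint A := by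
    rw [skewAdjoint.mem_iff]
    simp [wirtingerCLM_apply, star_smul]
  let _ : NormedAlgebra ℚ A := .restrictScalars ℚ ℂ A
  rcases subsingleton_or_nontrivial A with _ | _
  · rw [Subsingleton.elim (expWeyl a z) 0]; simp
  · exact (CStarRing.norm_of_mem_unitary (NormedSpace.exp_mem_unitary_of_mem_skewAdjoint h)).le

lemma commute_wirtingerCLM_star (a : A) [IsStarNormal a] (z w : ℂ) :
    Commute (wirtingerCLM (star a) (-a) z) (wirtingerCLM (star a) (-a) w) := by
  have h : Commute (star a) a := star_comm_self' a
  have h' : Commute a (star a) := h.symm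
  simp only [wirtingerCLM_apply]
  refine Commute.add_left (Commute.add_right ?_ ?_) (Commute.add_right ?_ ?_) <;>
    refine Commute.smul_left (Commute.smul_right ?_ _) _ <;> simp [h, h']

lemma expWeyl_add (a : A) [IsStarNormal a] (z w : ℂ) :
    expWeyl a (z + w) = expWeyl a z * expWeyl a w := by
  let _ : NormedAlgebra ℚ A := .restrictScalars ℚ ℂ A
  simp only [expWeyl, map_add]
  exact NormedSpace.exp_add_of_commute (commute_wirtingerCLM_star a z w)

lemma hasFDerivAt_expWeyl (a : A) [IsStarNormal a] (z : ℂ) :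
    HasFDerivAt (expWeyl a)
      ((ContinuousLinearMap.mul ℝ A (expWeyl a z)).comp (wirtingerCLM (star a) (-a))) z := by
  have h0 : HasFDerivAt (NormedSpace.exp : A → A) (1 : A →L[ℝ] A)
      (wirtingerCLM (star a) (-a) (z - z)) := by
    rw [sub_self, map_zero]; exact hasFDerivAt_exp_zero
  have h1 : HasFDerivAt (fun w : ℂ => wirtingerCLM (star a) (-a) (w - z))
      (wirtingerCLM (star a) (-a)) z :=
    (wirtingerCLM (star a) (-a)).hasFDerivAt.comp z ((hasFDerivAt_id z).sub_const z)
  have h2 := ((ContinuousLinearMap.mul ℝ A (expWeyl a z)).hasFDerivAt).comp z (h0.comp z h1)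
  refine h2.congr_of_eventuallyEq (.of_forall fun w => ?_) |>.congr_fderiv ?_
  · have := expWeyl_add a z (w - z)
    simpa [expWeyl] using this
  · ext; simp

/-- Conjugation of `r` by the unitaries `expWeyl`. -/
def weylConj (a b r : A) (z : ℂ) : A := expWeyl b z * r * expWeyl a (-z)

lemma norm_weylConj_le (a b r : A) (z : ℂ) : ‖weylConj a b r z‖ ≤ ‖r‖ := by
  calc _ ≤ ‖expWeyl b z‖ * ‖r‖ * ‖expWeyl a (-z)‖ :=
        (norm_mul_le _ _).trans (by gcongr; exact norm_mul_le _ _)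
    _ ≤ 1 * ‖r‖ * 1 := by gcongr <;> exact norm_expWeyl_le _ _
    _ = ‖r‖ := by ring

lemma hasFDerivAt_weylConj (a b r : A) [IsStarNormal a] [IsStarNormal b] (z : ℂ) :
    HasFDerivAt (weylConj a b r)
      (wirtingerCLM (weylConj a b (star b * r - r * star a) z)
        (weylConj a b (r * a - b * r) z)) z := by
  have hb := (hasFDerivAt_expWeyl b z).mul_const' r
  have ha := (hasFDerivAt_expWeyl a (-z)).comp z (hasFDerivAt_id (𝕜 := ℝ) z).neg
  refine (hb.mul' ha).congr_fderiv ?_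
  have hc : Commute (expWeyl a (-z)) (star a) := by
    refine Commute.exp_left ?_
    rw [wirtingerCLM_apply]
    exact ((Commute.refl _).smul_left _).add_left
      ((Commute.symm (star_comm_self' a)).neg_left.smul_left _)
  have hc' : Commute (expWeyl a (-z)) a := by
    refine Commute.exp_left ?_
    rw [wirtingerCLM_apply]
    exact (Commute.smul_left (star_comm_self' a) _).add_left
      ((Commute.refl a).neg_left.smul_left _)
  ext h
  simp [weylConj, mul_sub, sub_mul, mul_add, mul_assoc, ← hc.eq, ← hc'.eq, smul_sub]
  abel

lemma continuous_weylConj (a b r : A) [IsStarNormal a] [IsStarNormal b] :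
    Continuous (weylConj a b r) :=
  continuous_iff_continuousAt.2 fun z => (hasFDerivAt_weylConj a b r z).continuousAt

lemma wirtingerCLM_weylConj_apply (a b r : A) (z h : ℂ) :
    wirtingerCLM (weylConj a b (star b * r - r * star a) z) (weylConj a b (r * a - b * r) z) h =
      weylConj a b (wirtingerCLM (star b * r - r * star a) (r * a - b * r) h) z := by
  simp [weylConj, mul_add, add_mul]

lemma norm_wirtingerCLM_commutator_le (a b r : A) (h : ℂ) :
    ‖wirtingerCLM (star b * r - r * star a) (r * a - b * r) h‖ ≤
      2 * (‖a‖ + ‖b‖) * ‖r‖ * ‖h‖ := by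
  have h1 : ‖star b * r - r * star a‖ ≤ ‖b‖ * ‖r‖ + ‖r‖ * ‖a‖ := by
    refine (norm_sub_le _ _).trans (add_le_add ?_ ?_) <;>
    · refine (norm_mul_le _ _).trans ?_
      simp
  have h2 : ‖r * a - b * r‖ ≤ ‖r‖ * ‖a‖ + ‖b‖ * ‖r‖ :=
    (norm_sub_le _ _).trans (add_le_add (norm_mul_le _ _) (norm_mul_le _ _))
  rw [wirtingerCLM_apply]
  refine (norm_add_le _ _).trans ?_
  rw [norm_smul, norm_smul, RCLike.norm_conj]
  have := norm_nonneg h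
  nlinarith

lemma norm_weylConj_sub_le (a b r : A) [IsStarNormal a] [IsStarNormal b] (z : ℂ) :
    ‖weylConj a b r z - r‖ ≤ 2 * (‖a‖ + ‖b‖) * ‖r‖ * ‖z‖ := by
  have h := convex_univ.norm_image_sub_le_of_norm_hasFDerivWithin_le (𝕜 := ℝ)
    (f := weylConj a b r) (C := 2 * (‖a‖ + ‖b‖) * ‖r‖)
    (fun x _ => (hasFDerivAt_weylConj a b r x).hasFDerivWithinAt)
    (fun x _ => ContinuousLinearMap.opNorm_le_bound _ (by positivity) fun k => by
      rw [wirtingerCLM_weylConj_apply]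
      exact (norm_weylConj_le _ _ _ _).trans (norm_wirtingerCLM_commutator_le a b r k))
    (Set.mem_univ 0) (Set.mem_univ z)
  simpa [weylConj] using h

lemma norm_weylConj_taylor_le (a b r : A) [IsStarNormal a] [IsStarNormal b] (z : ℂ) :
    ‖weylConj a b r z - weylConj a b r 0 -
      wirtingerCLM (weylConj a b (star b * r - r * star a) 0)
        (weylConj a b (r * a - b * r) 0) z‖ ≤ 4 * (‖a‖ + ‖b‖) ^ 2 * ‖r‖ * ‖z‖ ^ 2 := by
  set T := wirtingerCLM (weylConj a b (star b * r - r * star a) 0)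
        (weylConj a b (r * a - b * r) 0)
  have h := (convex_closedBall (0 : ℂ) ‖z‖).norm_image_sub_le_of_norm_hasFDerivWithin_le (𝕜 := ℝ)
    (f := fun x => weylConj a b r x - T x) (C := 4 * (‖a‖ + ‖b‖) ^ 2 * ‖r‖ * ‖z‖)
    (fun x _ => ((hasFDerivAt_weylConj a b r x).sub T.hasFDerivAt).hasFDerivWithinAt)
    (fun x hx => ContinuousLinearMap.opNorm_le_bound _ (by positivity) fun k => by
      rw [sub_apply, wirtingerCLM_weylConj_apply, wirtingerCLM_weylConj_apply]
      set c := wirtingerCLM (star b * r - r * star a) (r * a - b * r) k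
      have hc : weylConj a b c 0 = c := by simp [weylConj]
      have hx' : ‖x‖ ≤ ‖z‖ := by simpa using hx
      rw [hc]
      calc _ ≤ 2 * (‖a‖ + ‖b‖) * ‖c‖ * ‖x‖ := norm_weylConj_sub_le a b c x
        _ ≤ 2 * (‖a‖ + ‖b‖) * (2 * (‖a‖ + ‖b‖) * ‖r‖ * ‖k‖) * ‖z‖ := by
          gcongr; exact norm_wirtingerCLM_commutator_le a b r k
        _ = _ := by ring)
    (show (0 : ℂ) ∈ _ by simp) (show z ∈ _ by simp)
  calc _ = ‖weylConj a b r z - T z - (weylConj a b r 0 - T 0)‖ := by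
        rw [map_zero, sub_zero]; congr 1; abel
    _ ≤ _ := h
    _ = _ := by rw [sub_zero]; ring

/-- The quasicommutator estimate for normal elements of a C⋆-algebra. -/
theorem norm_quasicommutator_star_le (a b r : A) [IsStarNormal a] [IsStarNormal b]
    (hr : ‖r‖ ≤ 1) (hne : r * a - b * r ≠ 0) :
    ‖r * star a - star b * r‖ ≤
      14 * Real.log (2 * (‖a‖ + ‖b‖) / ‖r * a - b * r‖) * ‖r * a - b * r‖ := by
  set δ := ‖r * a - b * r‖ with hδ
  set M := ‖a‖ + ‖b‖ with hM
  have hδ0 : 0 < δ := norm_pos_iff.2 hne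
  have hδM : δ ≤ M := by
    calc δ ≤ ‖r‖ * ‖a‖ + ‖b‖ * ‖r‖ :=
          (norm_sub_le _ _).trans (add_le_add (norm_mul_le _ _) (norm_mul_le _ _))
      _ ≤ 1 * ‖a‖ + ‖b‖ * 1 := by gcongr
      _ = M := by rw [hM]; ring
  have hM0 : 0 < M := hδ0.trans_le hδM
  have hlog : Real.log δ ≤ Real.log M := Real.log_le_log hδ0 hδM
  have h := norm_wirtinger_le (s := Real.log δ - 2 * Real.log M) (t := -Real.log δ) (δ := δ)
    (K := 4 * M ^ 2 * ‖r‖)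
    (hasFDerivAt_weylConj a b r) (fun z => (norm_weylConj_le a b r z).trans hr)
    (continuous_weylConj a b _) (fun z => norm_weylConj_le a b _ z)
    (norm_weylConj_taylor_le a b r) (by linarith)
  have hP : ‖weylConj a b (star b * r - r * star a) 0‖ = ‖r * star a - star b * r‖ := by
    simp [weylConj, norm_sub_rev]
  have hexp : Real.exp (Real.log δ - 2 * Real.log M) = δ / M ^ 2 := by
    rw [Real.exp_sub, Real.exp_log hδ0, two_mul, Real.exp_add, Real.exp_log hM0, sq]
  rw [hP, neg_neg, Real.exp_log hδ0, hexp] at h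
  have hK : 4 * M ^ 2 * ‖r‖ * (δ / M ^ 2) ≤ 4 * δ := by
    have : 4 * M ^ 2 * ‖r‖ * (δ / M ^ 2) = 4 * δ * ‖r‖ := by field_simp
    rw [this]
    exact mul_le_of_le_one_right (by positivity) hr
  rw [Real.log_div (by positivity) hδ0.ne', Real.log_mul two_ne_zero hM0.ne']
  have hl2 : 0.5 < Real.log 2 := by linarith [Real.log_two_gt_d9]
  nlinarith

end Exponential

end

/-- Corollary 6.2: for normal operators `N₁, N₂` and a contraction `R` with
`RN₁ - N₂R ≠ 0`, one has
`‖RN₁* - N₂*R‖ ≤ C log(2(‖N₁‖ + ‖N₂‖)/‖RN₁ - N₂R‖) ‖RN₁ - N₂R‖`. -/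
theorem stmt_16 :
    ∃ C > (0 : ℝ),
      ∀ (H : Type) [NormedAddCommGroup H] [InnerProductSpace ℂ H] [CompleteSpace H]
        (N₁ N₂ R : H →L[ℂ] H), IsStarNormal N₁ → IsStarNormal N₂ → ‖R‖ ≤ 1 →
        R * N₁ - N₂ * R ≠ 0 →
        ‖R * star N₁ - star N₂ * R‖ ≤
          C * Real.log (2 * (‖N₁‖ + ‖N₂‖) / ‖R * N₁ - N₂ * R‖) * ‖R * N₁ - N₂ * R‖ := by
  refine ⟨14, by norm_num, fun H _ _ _ N₁ N₂ R h₁ h₂ hR hne => ?_⟩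
  exact norm_quasicommutator_star_le N₁ N₂ R hR hne
end

section
/- There exists a constant c > 0 with the following property: for every α ∈ (0, 1) and every K ≥ 0, if ‖f(A) − f(B)‖ ≤ K·‖A − B‖^α holds for every function f : ℝ → ℝ satisfying |f(x) − f(y)| ≤ |x − y|^α for all x, y ∈ ℝ and for all bounded self-adjoint operators A ≠ B on a separable infinite-dimensional complex Hilbert space, then K ≥ c·(1 − α)^{−1/2}. In other words, the best constant 𝔥_α in the operator Hölder inequality satisfies 𝔥_α ≥ c·(1 − α)^{−1/2}. -/
/-- Points `p`, values `q` and an antisymmetric kernel `R` on `2 ^ n` indices, organised so that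
`(p x - p y) * R x y` is bounded as a matrix while `(q x - q y) * R x y` has large sum. -/
structure OscillatingSystem (n : ℕ) (ι : Type) [Fintype ι] [DecidableEq ι] where
  p : ι → ℝ
  q : ι → ℝ
  R : ι → ι → ℝ
  card_eq : (Fintype.card ι : ℝ) = 2 ^ n
  p_nonneg : ∀ x, 0 ≤ p x
  p_le : ∀ x, p x ≤ (4 ^ n - 1) / 3
  abs_q_sub_le : ∀ x y, |q x - q y| ≤ (4 ^ n - 1) / 3
  lipschitz : ∀ x y, |q x - q y| ≤ 2 * |p x - p y|
  antisymm : ∀ x y, R y x = -R x y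
  row_sum : ∀ x, ∑ y, (p x - p y) * R x y = (1 - (-1) ^ n) / 2
  sq_eq : ∀ x y, ∑ z, (p x - p z) * R x z * ((p z - p y) * R z y) =
    (p x - p y) * R x y + 2 * (if x = y then 1 else 0) - 2 / 2 ^ n
  abs_row_sum_le : ∀ x, |∑ y, R x y| ≤ 2 * (1 - 1 / 4 ^ n)
  le_sum : n * 2 ^ n / 2 ≤ ∑ x, ∑ y, (q x - q y) * R x y

namespace OscillatingSystem

variable {n : ℕ} {ι : Type} [Fintype ι] [DecidableEq ι]

/-- The one-point system. -/
def zero : OscillatingSystem 0 Unit where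
  p _ := 0
  q _ := 0
  R _ _ := 0
  card_eq := by simp
  p_nonneg := by simp
  p_le := by simp
  abs_q_sub_le := by simp
  lipschitz := by simp
  antisymm := by simp
  row_sum := by simp
  sq_eq := by simp
  abs_row_sum_le := by simp
  le_sum := by simp

section succ

variable (D : OscillatingSystem n ι)

/-- Two copies of the points, the second one translated by `4 ^ n`. -/
def succP (i : Bool × ι) : ℝ := (if i.1 then 4 ^ n else 0) + D.p i.2

/-- Two copies of the values, the second one translated by `(-4) ^ n`. -/
def succQ (i : Bool × ι) : ℝ := (if i.1 then (-1) ^ n * 4 ^ n else 0) + D.q i.2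

/-- Two copies of the kernel, coupled so that `(p x - p y) * R x y` is constant
off the diagonal blocks. -/
noncomputable def succR (i j : Bool × ι) : ℝ :=
  if i.1 = j.1 then D.R i.2 j.2 else (-1) ^ n / 2 ^ n / (D.succP i - D.succP j)

lemma abs_p_sub_le (x y : ι) : |D.p x - D.p y| ≤ (4 ^ n - 1) / 3 := by
  have := D.p_nonneg x
  have := D.p_nonneg y
  have := D.p_le x
  have := D.p_le y
  rw [abs_le]
  constructor <;> linarith

lemma succP_sub_mul_succR (i j : Bool × ι) :
    (D.succP i - D.succP j) * D.succR i j =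
      if i.1 = j.1 then (D.p i.2 - D.p j.2) * D.R i.2 j.2 else (-1) ^ n / 2 ^ n := by
  obtain ⟨a, x⟩ := i
  obtain ⟨b, y⟩ := j
  have h := abs_le.1 (D.abs_p_sub_le x y)
  have hw : (1 : ℝ) ≤ 4 ^ n := one_le_pow₀ (by norm_num)
  by_cases hab : a = b
  · subst hab
    simp [succR, succP]
  · simp only [succR, hab, if_false]
    rw [mul_div_cancel₀]
    cases a <;> cases b <;> simp [succP] at hab ⊢
    · intro h0; linarith
    · intro h0; linarith

lemma abs_succR_off_le {a b : Bool} (hab : a ≠ b) (x y : ι) :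
    |D.succR (a, x) (b, y)| ≤ 1 / 2 ^ n * (3 / 2 / 4 ^ n) := by
  have h := abs_le.1 (D.abs_p_sub_le x y)
  have hw : (1 : ℝ) ≤ 4 ^ n := one_le_pow₀ (by norm_num)
  have h2 : 2 / 3 * 4 ^ n ≤ |D.succP (a, x) - D.succP (b, y)| := by
    rw [le_abs]
    cases a <;> cases b <;> simp [succP] at hab ⊢
    · right; linarith
    · left; linarith
  simp only [succR, hab, if_false]
  rw [abs_div, abs_div, abs_pow, abs_neg, abs_one, one_pow, abs_of_pos (by positivity : (0:ℝ) < 2 ^ n),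
    div_eq_mul_inv (1 / 2 ^ n : ℝ)]
  gcongr
  rw [show (3 / 2 / 4 ^ n : ℝ) = (2 / 3 * 4 ^ n)⁻¹ by field_simp]
  gcongr

lemma le_succQ_sub_mul_succR_off {a b : Bool} (hab : a ≠ b) (x y : ι) :
    1 / 2 / 2 ^ n ≤ (D.succQ (a, x) - D.succQ (b, y)) * D.succR (a, x) (b, y) := by
  have h := abs_le.1 (D.abs_p_sub_le x y)
  have h' := abs_le.1 (D.abs_q_sub_le x y)
  have hw : (1 : ℝ) ≤ 4 ^ n := one_le_pow₀ (by norm_num)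
  have key : ∀ u v : ℝ, 0 < v → v ≤ 2 * u → (1 / 2 / 2 ^ n : ℝ) ≤ u * (1 / 2 ^ n / v) := by
    intro u v hv huv
    rw [show u * (1 / 2 ^ n / v) = (u / v) / 2 ^ n by ring]
    have : 1 / 2 ≤ u / v := by
      rw [le_div_iff₀ hv]
      linarith
    gcongr
  simp only [succR, hab, if_false]
  rcases neg_one_pow_eq_or ℝ n with hs | hs <;>
    cases a <;> cases b <;> simp [succP, succQ, hs] at hab ⊢
  · have := key (4 ^ n + D.q y - D.q x) (4 ^ n + D.p y - D.p x) (by linarith) (by linarith)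
    convert this using 1
    · ring
    · rw [show D.p x - (4 ^ n + D.p y) = -(4 ^ n + D.p y - D.p x) by ring, div_neg]; ring
  · have := key (4 ^ n + D.q x - D.q y) (4 ^ n + D.p x - D.p y) (by linarith) (by linarith)
    convert this using 1 <;> ring
  · have := key (4 ^ n - D.q y + D.q x) (4 ^ n + D.p y - D.p x) (by linarith) (by linarith)
    convert this using 1
    · ring
    · rw [show D.p x - (4 ^ n + D.p y) = -(4 ^ n + D.p y - D.p x) by ring, div_neg]; ring
  · have := key (4 ^ n - D.q x + D.q y) (4 ^ n + D.p x - D.p y) (by linarith) (by linarith)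
    convert this using 1 <;> ring

lemma succ_lipschitz (i j : Bool × ι) :
    |D.succQ i - D.succQ j| ≤ 2 * |D.succP i - D.succP j| := by
  obtain ⟨a, x⟩ := i
  obtain ⟨b, y⟩ := j
  have h := abs_le.1 (D.abs_p_sub_le x y)
  have h' := abs_le.1 (D.abs_q_sub_le x y)
  have hw : (1 : ℝ) ≤ 4 ^ n := one_le_pow₀ (by norm_num)
  cases a <;> cases b <;> simp [succP, succQ]
  · exact D.lipschitz x y
  · rw [abs_of_nonpos (by linarith : D.p x - (4 ^ n + D.p y) ≤ 0)]
    rcases neg_one_pow_eq_or ℝ n with hs | hs <;> rw [hs, abs_le] <;> constructor <;> linarith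
  · rw [abs_of_nonneg (by linarith : 0 ≤ 4 ^ n + D.p x - D.p y)]
    rcases neg_one_pow_eq_or ℝ n with hs | hs <;> rw [hs, abs_le] <;> constructor <;> linarith
  · exact D.lipschitz x y

lemma abs_succQ_sub_le (i j : Bool × ι) : |D.succQ i - D.succQ j| ≤ (4 ^ (n + 1) - 1) / 3 := by
  obtain ⟨a, x⟩ := i
  obtain ⟨b, y⟩ := j
  have h' := abs_le.1 (D.abs_q_sub_le x y)
  have hw : (1 : ℝ) ≤ 4 ^ n := one_le_pow₀ (by norm_num)
  rw [pow_succ]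
  cases a <;> cases b <;> simp [succQ] <;>
    rcases neg_one_pow_eq_or ℝ n with hs | hs <;> try simp only [hs]
  all_goals rw [abs_le]; constructor <;> linarith

/-- The doubled system. -/
noncomputable def succ : OscillatingSystem (n + 1) (Bool × ι) where
  p := D.succP
  q := D.succQ
  R := D.succR
  card_eq := by
    rw [Fintype.card_prod, Fintype.card_bool]
    push_cast
    rw [D.card_eq, pow_succ']
  p_nonneg := by
    rintro ⟨a, x⟩
    have := D.p_nonneg x
    unfold succP
    positivity
  p_le := by
    rintro ⟨a, x⟩
    have := D.p_le x
    have hw : (1 : ℝ) ≤ 4 ^ n := one_le_pow₀ (by norm_num)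
    rw [pow_succ]
    cases a <;> simp [succP] <;> linarith
  abs_q_sub_le := D.abs_succQ_sub_le
  lipschitz := D.succ_lipschitz
  antisymm := by
    rintro ⟨a, x⟩ ⟨b, y⟩
    by_cases hab : a = b
    · subst hab
      simp [succR, D.antisymm x y]
    · simp only [succR, hab, Ne.symm hab, if_false]
      rw [← neg_sub, div_neg]
  row_sum := by
    rintro ⟨a, x⟩
    simp only [succP_sub_mul_succR]
    rw [Fintype.sum_prod_type, Fintype.sum_bool]
    cases a <;> simp [D.row_sum, D.card_eq, pow_succ] <;> field_simp <;> ring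
  sq_eq := by
    rintro ⟨a, x⟩ ⟨b, y⟩
    simp only [succP_sub_mul_succR]
    rw [Fintype.sum_prod_type, Fintype.sum_bool]
    have hc : ∀ z y, (D.p z - D.p y) * D.R z y = (D.p y - D.p z) * D.R y z := by
      intro z y
      rw [D.antisymm y z]; ring
    have hcol : ∀ y, ∑ z, (D.p z - D.p y) * D.R z y = (1 - (-1) ^ n) / 2 := by
      intro y
      rw [← D.row_sum y]
      exact Finset.sum_congr rfl fun z _ => hc z y
    have hs : ((-1 : ℝ) ^ n) ^ 2 = 1 := by rw [← pow_mul, mul_comm, pow_mul]; simp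
    have hN : (2 : ℝ) ^ n ≠ 0 := by positivity
    cases a <;> cases b <;>
      simp [← Finset.mul_sum, ← Finset.sum_mul, D.sq_eq, D.row_sum, hcol, D.card_eq, pow_succ] <;>
      field_simp <;> ring_nf
    all_goals rw [pow_mul, hs]; ring
  abs_row_sum_le := by
    rintro ⟨a, x⟩
    have hoff : ∀ b, a ≠ b → |∑ y, D.succR (a, x) (b, y)| ≤ 3 / 2 / 4 ^ n := by
      intro b hab
      refine (Finset.abs_sum_le_sum_abs _ _).trans ?_
      refine (Finset.sum_le_sum fun y _ => D.abs_succR_off_le hab x y).trans ?_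
      rw [Finset.sum_const, Finset.card_univ, nsmul_eq_mul, D.card_eq]
      apply le_of_eq
      field_simp
    have hon : |∑ y, D.succR (a, x) (a, y)| ≤ 2 * (1 - 1 / 4 ^ n) := by
      simpa [succR] using D.abs_row_sum_le x
    rw [Fintype.sum_prod_type, Fintype.sum_bool]
    have h4 : 2 * (1 - 1 / 4 ^ n) + 3 / 2 / 4 ^ n = (2 * (1 - 1 / 4 ^ (n + 1)) : ℝ) := by
      rw [pow_succ]; field_simp; ring
    rw [← h4]
    refine (abs_add_le _ _).trans ?_
    cases a
    · rw [add_comm]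
      exact add_le_add hon (hoff true (by simp))
    · exact add_le_add hon (hoff false (by simp))
  le_sum := by
    have hoff : ∀ a b : Bool, a ≠ b →
        2 ^ n / 2 ≤ ∑ x, ∑ y, (D.succQ (a, x) - D.succQ (b, y)) * D.succR (a, x) (b, y) := by
      intro a b hab
      refine le_trans (le_of_eq ?_) (Finset.sum_le_sum fun x _ => Finset.sum_le_sum fun y _ =>
        D.le_succQ_sub_mul_succR_off hab x y)
      simp only [Finset.sum_const, Finset.card_univ, nsmul_eq_mul, D.card_eq]
      field_simp
    have hon : ∀ a : Bool,
        n * 2 ^ n / 2 ≤ ∑ x, ∑ y, (D.succQ (a, x) - D.succQ (a, y)) * D.succR (a, x) (a, y) := by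
      intro a
      simpa [succR, succQ] using D.le_sum
    simp only [Fintype.sum_prod_type, Fintype.sum_bool, Finset.sum_add_distrib]
    have h1 := hon true
    have h2 := hon false
    have h3 := hoff true false (by simp)
    have h4 := hoff false true (by simp)
    rw [pow_succ]
    push_cast
    linarith

end succ

theorem exists_nonempty : ∀ n : ℕ, ∃ (ι : Type) (_ : Fintype ι) (_ : DecidableEq ι),
    Nonempty (OscillatingSystem n ι)
  | 0 => ⟨Unit, inferInstance, inferInstance, ⟨zero⟩⟩
  | n + 1 => by
    obtain ⟨ι, _, _, ⟨D⟩⟩ := exists_nonempty n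
    exact ⟨Bool × ι, inferInstance, inferInstance, ⟨D.succ⟩⟩

end OscillatingSystem

open scoped Pointwise in
/-- The Cayley transform of a skew-adjoint element `R`, with the commutator estimates relating it
to `R`. -/
lemma exists_unitary_commutator {A : Type*} [CStarAlgebra A] {R : A} (hR : star R = -R) :
    ∃ U ∈ unitary A, (∀ a, (1 - R) * (a * U - U * a) * (1 - R) = 2 * (a * R - R * a)) ∧
      ∀ a, ‖a * U - U * a‖ ≤ 2 * ‖a * R - R * a‖ := by
  have hu : IsUnit (1 - R) := by
    have hsa : IsSelfAdjoint (Complex.I • R) := by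
      simp [IsSelfAdjoint, hR]
    by_contra h
    have h1 : (1 : ℂ) ∈ spectrum ℂ R := by
      rwa [spectrum.mem_iff, map_one]
    have h2 : Complex.I ∈ spectrum ℂ (Complex.I • R) := by
      have := spectrum.unit_smul_eq_smul R (Units.mk0 Complex.I Complex.I_ne_zero)
      rw [Units.smul_mk0, Units.smul_mk0] at this
      rw [this]
      exact ⟨1, h1, by simp⟩
    have := hsa.mem_spectrum_eq_re h2
    simpa using congrArg Complex.im this
  obtain ⟨u, hu⟩ := hu
  set X : A := ↑u⁻¹ with hX
  have hRu : R = 1 - u := by rw [hu]; abel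
  have hl : (1 - R) * X = 1 := by rw [← hu]; simp [hX]
  have hr : X * (1 - R) = 1 := by rw [← hu]; simp [hX]
  have hl' : star X * (1 + R) = 1 := by
    simpa [hR] using congrArg star hl
  have hr' : (1 + R) * star X = 1 := by
    simpa [hR] using congrArg star hr
  have h1 : X + star X = 2 * (X * star X) := by
    calc X + star X = X * ((1 + R) * star X) + (X * (1 - R)) * star X := by rw [hr', hr]; simp
      _ = _ := by noncomm_ring
  have h2 : X + star X = 2 * (star X * X) := by
    calc X + star X = (star X * (1 + R)) * X + star X * ((1 - R) * X) := by rw [hl', hl]; simp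
      _ = _ := by noncomm_ring
  have hU : 2 * X - 1 ∈ unitary A := by
    rw [Unitary.mem_iff]
    constructor
    · calc star (2 * X - 1) * (2 * X - 1) = 2 * (2 * (star X * X)) - 2 * (X + star X) + 1 := by
            simp only [star_sub, star_mul, star_one, star_ofNat]; noncomm_ring
        _ = 1 := by rw [← h2]; abel
    · calc (2 * X - 1) * star (2 * X - 1) = 2 * (2 * (X * star X)) - 2 * (X + star X) + 1 := by
            simp only [star_sub, star_mul, star_one, star_ofNat]; noncomm_ring
        _ = 1 := by rw [← h1]; abel
  have hX1 : ‖X‖ ≤ 1 := by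
    nontriviality A
    have hn : ‖(2 : ℂ) • X‖ ≤ 1 + 1 := by
      calc ‖(2 : ℂ) • X‖ = ‖(2 * X - 1) + 1‖ := by rw [sub_add_cancel, two_smul, two_mul]
        _ ≤ 1 + 1 := (norm_add_le _ _).trans (by rw [CStarRing.norm_of_mem_unitary hU, norm_one])
    rw [norm_smul] at hn
    norm_num at hn
    linarith
  have hcomm : ∀ a, a * (2 * X - 1) - (2 * X - 1) * a = 2 * (X * (a * R - R * a) * X) := by
    intro a
    calc a * (2 * X - 1) - (2 * X - 1) * a
        = 2 * ((X * (1 - R)) * a * X) - 2 * (X * a * ((1 - R) * X)) := by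
          rw [hl, hr]; noncomm_ring
      _ = _ := by noncomm_ring
  refine ⟨2 * X - 1, hU, fun a => ?_, fun a => ?_⟩
  · rw [hcomm]
    calc (1 - R) * (2 * (X * (a * R - R * a) * X)) * (1 - R)
        = 2 * (((1 - R) * X) * (a * R - R * a) * (X * (1 - R))) := by noncomm_ring
      _ = _ := by rw [hl, hr]; simp
  · rw [hcomm, two_mul]
    have : ‖X * (a * R - R * a) * X‖ ≤ ‖a * R - R * a‖ := by
      calc ‖X * (a * R - R * a) * X‖ ≤ ‖X‖ * ‖a * R - R * a‖ * ‖X‖ := norm_mul₃_le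
        _ ≤ 1 * ‖a * R - R * a‖ * 1 := by gcongr
        _ = _ := by ring
    exact (norm_add_le _ _).trans (by linarith)

section embedding

variable {ι H : Type*} [Fintype ι] [DecidableEq ι] [NormedAddCommGroup H] [InnerProductSpace ℂ H]
  [CompleteSpace H] (V : EuclideanSpace ℂ ι →ₗᵢ[ℂ] H)

open ContinuousLinearMap

/-- Matrices as operators on the range of an isometry, extended by zero. -/
noncomputable def matrixEmbedding : Matrix ι ι ℂ →⋆ₙₐ[ℂ] (H →L[ℂ] H) where
  toFun a := V.toContinuousLinearMap ∘L (Matrix.toEuclideanCLM (𝕜 := ℂ) a) ∘L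
    adjoint V.toContinuousLinearMap
  map_smul' c a := by ext; simp
  map_zero' := by ext; simp
  map_add' a b := by ext; simp
  map_mul' a b := by
    have h (x) : adjoint V.toContinuousLinearMap (V x) = x :=
      congrArg (fun T : EuclideanSpace ℂ ι →L[ℂ] EuclideanSpace ℂ ι => T x) V.adjoint_comp_self
    ext; simp [h]
  map_star' a := by
    simp only [map_star, star_eq_adjoint, adjoint_comp, adjoint_adjoint, comp_assoc]

lemma matrixEmbedding_apply (a : Matrix ι ι ℂ) (v : EuclideanSpace ℂ ι) :
    matrixEmbedding V a (V v) = V (Matrix.toEuclideanCLM (𝕜 := ℂ) a v) := by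
  have h (x) : adjoint V.toContinuousLinearMap (V x) = x :=
    congrArg (fun T : EuclideanSpace ℂ ι →L[ℂ] EuclideanSpace ℂ ι => T x) V.adjoint_comp_self
  simp [matrixEmbedding, h]

lemma matrixEmbedding_diagonal_ofReal_isSelfAdjoint (p : ι → ℝ) :
    IsSelfAdjoint (matrixEmbedding V (Matrix.diagonal fun i => (p i : ℂ))) := by
  refine IsSelfAdjoint.map ?_ _
  simp [IsSelfAdjoint, Matrix.star_eq_conjTranspose, Matrix.diagonal_conjTranspose, Pi.star_def]

/-- Diagonal matrices as a star homomorphism. -/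
def diagonalStarHom (ι : Type*) [Fintype ι] [DecidableEq ι] : (ι → ℂ) →⋆ₙₐ[ℂ] Matrix ι ι ℂ where
  toFun := Matrix.diagonal
  map_smul' c a := by ext; simp
  map_zero' := by simp
  map_add' a b := by simp
  map_mul' a b := by rw [Matrix.diagonal_mul_diagonal]; rfl
  map_star' a := by rw [Matrix.star_eq_conjTranspose, Matrix.diagonal_conjTranspose]

lemma cfc_matrixEmbedding_diagonal (p : ι → ℝ) {f : ℝ → ℝ} (hf : Continuous f) (h0 : f 0 = 0) :
    cfc f (matrixEmbedding V (Matrix.diagonal fun i => (p i : ℂ))) =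
      matrixEmbedding V (Matrix.diagonal fun i => (f (p i) : ℂ)) := by
  have hp : IsSelfAdjoint (fun i => (p i : ℂ)) := by
    ext i; simp
  have hcfc : cfcₙ f (fun i => (p i : ℂ)) = fun i => (f (p i) : ℂ) := by
    rw [cfcₙ_map_pi (S := ℂ) f _ hf.continuousOn hp (fun i => by simp [IsSelfAdjoint])]
    ext i
    rw [cfcₙ_eq_cfc hf.continuousOn h0]
    exact cfc_algebraMap (A := ℂ) (p i) f
  let ψ : (ι → ℂ) →⋆ₙₐ[ℂ] (H →L[ℂ] H) := (matrixEmbedding V).comp (diagonalStarHom ι)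
  have hψ : Continuous ψ :=
    LinearMap.continuous_of_finiteDimensional (ψ : (ι → ℂ) →ₗ[ℂ] (H →L[ℂ] H))
  have := ψ.map_cfcₙ f (fun i => (p i : ℂ)) hf.continuousOn h0 hψ hp
    (matrixEmbedding_diagonal_ofReal_isSelfAdjoint V p)
  rw [hcfc, cfcₙ_eq_cfc hf.continuousOn h0] at this
  exact this.symm

end embedding

lemma cfc_unitary_conj_s19 {H : Type*} [NormedAddCommGroup H] [InnerProductSpace ℂ H]
    [CompleteSpace H] {U A : H →L[ℂ] H} (hU : U ∈ unitary (H →L[ℂ] H)) (hA : IsSelfAdjoint A)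
    {f : ℝ → ℝ} (hf : Continuous f) : cfc f (U * A * star U) = U * cfc f A * star U := by
  have hc : Continuous (Unitary.conjStarAlgAut ℂ _ ⟨U, hU⟩ : (H →L[ℂ] H) → (H →L[ℂ] H)) := by
    change Continuous fun a => U * a * star U
    fun_prop
  exact (StarAlgHomClass.map_cfc (S := ℂ) (Unitary.conjStarAlgAut ℂ _ ⟨U, hU⟩) f A
    hf.continuousOn hc hA (hA.conjugate U)).symm

lemma norm_sub_unitary_conj {A : Type*} [CStarAlgebra A] {U : A} (hU : U ∈ unitary A) (a : A) :
    ‖a - U * a * star U‖ = ‖a * U - U * a‖ := by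
  have : a - U * a * star U = (a * U - U * a) * star U := by
    rw [sub_mul, mul_assoc a, Unitary.mul_star_self_of_mem hU, mul_one]
  rw [this, CStarRing.norm_mul_mem_unitary _ (Unitary.star_mem hU)]

/-- Finitely many prescribed values extend to a function with controlled Hölder seminorm. -/
lemma exists_holder_extension {ι : Type*} {p q : ι → ℝ} {M α : ℝ} (hM : 0 < M) (hα : 0 ≤ α)
    (hα' : α ≤ 1) (hp : ∀ x, p x ∈ Set.Icc 0 M) (hpq : ∀ x y, |q x - q y| ≤ 2 * |p x - p y|) :
    ∃ f : ℝ → ℝ, Continuous f ∧ f 0 = 0 ∧ (∀ x y, f (p x) - f (p y) = q x - q y) ∧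
      ∀ s t, |f s - f t| ≤ 2 * M ^ (1 - α) * |s - t| ^ α := by
  have hinj : ∀ x y, p x = p y → q x = q y := by
    intro x y h
    have := hpq x y
    rw [h, sub_self, abs_zero, mul_zero] at this
    exact sub_eq_zero.1 (abs_nonpos_iff.1 this)
  have hfac : ∀ x, Function.extend p q 0 (p x) = q x :=
    fun x => Function.FactorsThrough.extend_apply (fun a b => hinj a b) 0 x
  have hL : LipschitzOnWith 2 (Function.extend p q 0) (Set.range p) := by
    refine LipschitzOnWith.of_dist_le_mul ?_
    rintro _ ⟨x, rfl⟩ _ ⟨y, rfl⟩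
    rw [hfac, hfac, Real.dist_eq, Real.dist_eq]
    exact hpq x y
  obtain ⟨g, hg, hgq⟩ := hL.extend_real
  let c : ℝ → ℝ := fun t => max 0 (min M t)
  have hc : ∀ t, c t ∈ Set.Icc 0 M := fun t => ⟨le_max_left _ _, max_le hM.le (min_le_left _ _)⟩
  have hcp : ∀ t ∈ Set.Icc 0 M, c t = t := by
    rintro t ⟨h1, h2⟩
    simp [c, h1, h2]
  have hcl : ∀ s t, |c s - c t| ≤ |s - t| := by
    intro s t
    have := ((LipschitzWith.id.const_min M).const_max 0).dist_le_mul s t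
    simpa [Real.dist_eq] using this
  have hcM : ∀ s t, |c s - c t| ≤ M := by
    intro s t
    have h1 := hc s
    have h2 := hc t
    rw [abs_le]
    constructor <;> linarith [h1.1, h1.2, h2.1, h2.2]
  refine ⟨fun t => g (c t) - g (c 0), ?_, by simp, fun x y => ?_, fun s t => ?_⟩
  · have := hg.continuous
    fun_prop
  · rw [sub_sub_sub_cancel_right, hcp _ (hp x), hcp _ (hp y), ← hgq ⟨x, rfl⟩, ← hgq ⟨y, rfl⟩,
      hfac, hfac]
  · rw [sub_sub_sub_cancel_right, mul_assoc]
    have h1 : |g (c s) - g (c t)| ≤ 2 * |c s - c t| := hg.dist_le_mul _ _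
    refine h1.trans ?_
    gcongr
    calc |c s - c t| = |c s - c t| ^ (1 - α) * |c s - c t| ^ α := by
          rw [← Real.rpow_add' (abs_nonneg _) (by simp)]; simp
      _ ≤ M ^ (1 - α) * |s - t| ^ α := by
          exact mul_le_mul (Real.rpow_le_rpow (abs_nonneg _) (hcM s t) (by linarith))
            (Real.rpow_le_rpow (abs_nonneg _) (hcl s t) hα) (by positivity) (by positivity)

namespace OscillatingSystem

variable {n : ℕ} {ι : Type} [Fintype ι] [DecidableEq ι] (D : OscillatingSystem n ι)
  {H : Type*} [NormedAddCommGroup H] [InnerProductSpace ℂ H] [CompleteSpace H]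
  (V : EuclideanSpace ℂ ι →ₗᵢ[ℂ] H)

/-- The kernel `R` as a complex matrix. -/
def matR : Matrix ι ι ℂ := .of fun x y => (D.R x y : ℂ)

lemma diagonal_commutator (a : ι → ℝ) :
    Matrix.diagonal (fun i => (a i : ℂ)) * D.matR - D.matR * Matrix.diagonal (fun i => (a i : ℂ)) =
      .of fun x y => (((a x - a y) * D.R x y : ℝ) : ℂ) := by
  ext x y
  simp [matR]
  ring

lemma star_matrixEmbedding_matR : star (matrixEmbedding V D.matR) = -matrixEmbedding V D.matR := by
  rw [← map_star, ← map_neg]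
  congr 1
  ext x y
  simp [matR, Matrix.star_apply, D.antisymm x y]

omit [DecidableEq ι] in
/-- The normalised all-ones matrix is a projection. -/
lemma isStarProjection_average (h : (Fintype.card ι : ℝ) = 2 ^ n) :
    IsStarProjection (.of fun _ _ => 1 / 2 ^ n : Matrix ι ι ℂ) := by
  have h' : (Fintype.card ι : ℂ) = 2 ^ n := by exact_mod_cast congrArg (fun r : ℝ => (r : ℂ)) h
  constructor
  · ext x y
    simp [Matrix.mul_apply, h']
  · ext x y
    simp [Matrix.star_apply]

lemma norm_commutator_p_le :
    ‖matrixEmbedding V (.of fun x y => (((D.p x - D.p y) * D.R x y : ℝ) : ℂ))‖ ≤ 2 := by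
  set S : Matrix ι ι ℂ := .of fun x y => (((D.p x - D.p y) * D.R x y : ℝ) : ℂ) with hS
  set E : Matrix ι ι ℂ := .of fun _ _ => 1 / 2 ^ n with hE
  have hsa : star S = S := by
    ext x y
    rw [Matrix.star_apply, hS, Matrix.of_apply, Matrix.of_apply, D.antisymm x y, RCLike.star_def,
      Complex.conj_ofReal]
    congr 1
    ring
  have hsq : S * S = S + ((1 - E) + (1 - E)) := by
    ext x y
    have := congrArg (fun r : ℝ => (r : ℂ)) (D.sq_eq x y)
    simp only [Matrix.mul_apply, Matrix.add_apply, Matrix.sub_apply, Matrix.one_apply, hS, hE,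
      Matrix.of_apply]
    split_ifs at this ⊢ <;> push_cast at this ⊢ <;> rw [this] <;> ring
  have hP : ‖matrixEmbedding V (1 - E)‖ ≤ 1 :=
    IsStarProjection.norm_le _ ((isStarProjection_average D.card_eq).one_sub.map _)
  set T := matrixEmbedding V S with hT
  have h1 : ‖T‖ * ‖T‖ ≤ ‖T‖ + (1 + 1) := by
    calc ‖T‖ * ‖T‖ = ‖star T * T‖ := CStarRing.norm_star_mul_self.symm
      _ = ‖T + (matrixEmbedding V (1 - E) + matrixEmbedding V (1 - E))‖ := by
          rw [hT, ← map_star, hsa, ← map_mul, hsq, map_add, map_add]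
      _ ≤ ‖T‖ + (1 + 1) :=
          (norm_add_le _ _).trans (by gcongr; exact (norm_add_le _ _).trans (by gcongr))
  nlinarith [norm_nonneg T]

/-- The all-ones vector. -/
noncomputable def ones (ι : Type) [Fintype ι] : EuclideanSpace ℂ ι := WithLp.toLp 2 fun _ => 1

include D in
lemma norm_sq_ones : ‖ones ι‖ ^ 2 = 2 ^ n := by
  rw [EuclideanSpace.norm_sq_eq]
  simp [ones, D.card_eq]

lemma norm_matR_ones_le : ‖Matrix.toEuclideanCLM (𝕜 := ℂ) D.matR (ones ι)‖ ≤ 2 * ‖ones ι‖ := by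
  refine abs_le_of_sq_le_sq' ?_ (by positivity) |>.2
  rw [mul_pow, D.norm_sq_ones, EuclideanSpace.norm_sq_eq, ← D.card_eq]
  refine (Finset.sum_le_card_nsmul _ _ (2 ^ 2) fun x _ => ?_).trans (by simp [mul_comm])
  gcongr
  have h1 : Matrix.toEuclideanCLM (𝕜 := ℂ) D.matR (ones ι) x = ((∑ y, D.R x y : ℝ) : ℂ) := by
    simp [ones, matR, Matrix.mulVec, dotProduct]
  rw [h1, Complex.norm_real, Real.norm_eq_abs]
  refine (D.abs_row_sum_le x).trans ?_
  have : (0 : ℝ) ≤ 1 / 4 ^ n := by positivity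
  linarith

lemma inner_ones (a : Matrix ι ι ℂ) :
    inner ℂ (V (ones ι)) (matrixEmbedding V a (V (ones ι))) = ∑ x, ∑ y, a x y := by
  rw [matrixEmbedding_apply, V.inner_map_map, PiLp.inner_apply]
  simp [ones, Matrix.mulVec, dotProduct]

lemma le_norm_of_cayley {a : ι → ℝ} (ha : ∀ x y, a x - a y = D.q x - D.q y) {C : H →L[ℂ] H}
    (hC : (1 - matrixEmbedding V D.matR) * C * (1 - matrixEmbedding V D.matR) =
      2 * (matrixEmbedding V (Matrix.diagonal fun i => (a i : ℂ)) * matrixEmbedding V D.matR -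
        matrixEmbedding V D.matR * matrixEmbedding V (Matrix.diagonal fun i => (a i : ℂ)))) :
    n / 9 ≤ ‖C‖ := by
  set T := matrixEmbedding V D.matR with hT
  set v := V (ones ι) with hv
  have hvn : ‖v‖ = ‖ones ι‖ := V.norm_map _
  have hTv : ‖T v‖ ≤ 2 * ‖v‖ := by
    rw [hT, hv, matrixEmbedding_apply, V.norm_map, V.norm_map]
    exact D.norm_matR_ones_le
  have hinner : inner ℂ (v + T v) (C (v - T v)) =
      2 * ((∑ x, ∑ y, (D.q x - D.q y) * D.R x y : ℝ) : ℂ) := by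
    have h1 : inner ℂ v (((1 - T) * C * (1 - T)) v) = inner ℂ (v + T v) (C (v - T v)) := by
      have h2 : v + T v = ContinuousLinearMap.adjoint (1 - T) v := by
        have : ContinuousLinearMap.adjoint T = -T := D.star_matrixEmbedding_matR V
        rw [← ContinuousLinearMap.star_eq_adjoint, star_sub, star_one,
          ContinuousLinearMap.star_eq_adjoint, this]
        simp
      rw [h2, ContinuousLinearMap.adjoint_inner_left]
      rfl
    rw [← h1, hC, ← map_mul, ← map_mul, ← map_sub, D.diagonal_commutator, two_mul,
      add_apply, inner_add_right, inner_ones, two_mul]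
    simp [ha]
  have hbound := norm_inner_le_norm (𝕜 := ℂ) (v + T v) (C (v - T v))
  rw [hinner, norm_mul, Complex.norm_real, Real.norm_eq_abs, Complex.norm_ofNat] at hbound
  have h3 : ‖v + T v‖ ≤ 3 * ‖v‖ := (norm_add_le _ _).trans (by linarith)
  have h4 : ‖v - T v‖ ≤ 3 * ‖v‖ := (norm_sub_le _ _).trans (by linarith)
  have h5 : (n : ℝ) * 2 ^ n ≤ 9 * ‖C‖ * 2 ^ n := by
    calc (n : ℝ) * 2 ^ n = 2 * (n * 2 ^ n / 2) := by ring
      _ ≤ 2 * |∑ x, ∑ y, (D.q x - D.q y) * D.R x y| := by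
          gcongr
          exact D.le_sum.trans (le_abs_self _)
      _ ≤ ‖v + T v‖ * ‖C (v - T v)‖ := hbound
      _ ≤ (3 * ‖v‖) * (‖C‖ * (3 * ‖v‖)) := by
          gcongr
          exact (C.le_opNorm _).trans (by gcongr)
      _ = 9 * ‖C‖ * ‖ones ι‖ ^ 2 := by rw [hvn]; ring
      _ = _ := by rw [D.norm_sq_ones]
  have := le_of_mul_le_mul_right h5 (by positivity)
  linarith

include D V in
/-- An operator Hölder bound on a space containing the system forces a large constant. -/
lemma le_of_operator_holder {α K : ℝ} (hα : 0 ≤ α) (hα' : α ≤ 1) (hK : 0 ≤ K)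
    (h : ∀ f : ℝ → ℝ, (∀ x y : ℝ, |f x - f y| ≤ |x - y| ^ α) →
      ∀ A B : H →L[ℂ] H, IsSelfAdjoint A → IsSelfAdjoint B → A ≠ B →
        ‖cfc f A - cfc f B‖ ≤ K * ‖A - B‖ ^ α) :
    n / 9 ≤ 2 * (4 ^ n) ^ (1 - α) * (K * 4) := by
  obtain ⟨g, hg, hg0, hgq, hgα⟩ := exists_holder_extension (M := 4 ^ n) (by positivity) hα hα'
    (fun x => ⟨D.p_nonneg x, (D.p_le x).trans (by
      have : (1 : ℝ) ≤ 4 ^ n := one_le_pow₀ (by norm_num)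
      linarith)⟩) D.lipschitz
  set L : ℝ := 2 * (4 ^ n) ^ (1 - α) with hL
  have hLpos : 0 < L := by positivity
  obtain ⟨U, hU, hUeq, hUle⟩ := exists_unitary_commutator (D.star_matrixEmbedding_matR V)
  set A := matrixEmbedding V (Matrix.diagonal fun i => (D.p i : ℂ)) with hA
  have hAsa : IsSelfAdjoint A := matrixEmbedding_diagonal_ofReal_isSelfAdjoint V D.p
  let f : ℝ → ℝ := fun t => L⁻¹ * g t
  have hf : Continuous f := by fun_prop
  have hfα : ∀ s t, |f s - f t| ≤ |s - t| ^ α := by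
    intro s t
    rw [← mul_sub, abs_mul, abs_of_pos (inv_pos.2 hLpos), inv_mul_le_iff₀ hLpos]
    exact hgα s t
  have hdist : ‖A - U * A * star U‖ ≤ 4 := by
    rw [norm_sub_unitary_conj hU]
    refine (hUle A).trans ?_
    rw [hA, ← map_mul, ← map_mul, ← map_sub, D.diagonal_commutator]
    linarith [D.norm_commutator_p_le V]
  have hmain : ‖cfc f A - cfc f (U * A * star U)‖ ≤ K * 4 := by
    by_cases hne : A = U * A * star U
    · rw [← hne, sub_self, norm_zero]
      positivity
    · refine (h f hfα A _ hAsa (hAsa.conjugate U) hne).trans ?_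
      gcongr
      calc ‖A - U * A * star U‖ ^ α ≤ 4 ^ α := by gcongr
        _ ≤ 4 ^ (1 : ℝ) := by gcongr; norm_num
        _ = 4 := Real.rpow_one 4
  have hgf : cfc g A - cfc g (U * A * star U) = L • (cfc f A - cfc f (U * A * star U)) := by
    rw [cfc_const_mul L⁻¹ g A hg.continuousOn, cfc_const_mul L⁻¹ g _ hg.continuousOn, ← smul_sub,
      smul_inv_smul₀ hLpos.ne']
  have hn : n / 9 ≤ ‖cfc g A - cfc g (U * A * star U)‖ := by
    rw [cfc_unitary_conj_s19 hU hAsa hg, norm_sub_unitary_conj hU, hA,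
      cfc_matrixEmbedding_diagonal V D.p hg hg0]
    exact D.le_norm_of_cayley V hgq (hUeq _)
  refine hn.trans ?_
  rw [hgf, norm_smul, Real.norm_of_nonneg hLpos.le]
  gcongr

end OscillatingSystem

/-- Every infinite orthonormal family yields isometric copies of all finite-dimensional spaces. -/
lemma exists_linearIsometry_of_orthonormal {κ H : Type*} [Infinite κ] [NormedAddCommGroup H]
    [InnerProductSpace ℂ H] {b : κ → H} (hb : Orthonormal ℂ b) (ι : Type*) [Fintype ι] :
    Nonempty (EuclideanSpace ℂ ι →ₗᵢ[ℂ] H) := by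
  classical
  let e : ι ↪ κ := ((Fintype.equivFin ι).toEmbedding.trans Fin.valEmbedding).trans
    (Infinite.natEmbedding κ)
  let v := EuclideanSpace.basisFun ι ℂ
  refine ⟨(v.toBasis.constr ℂ (b ∘ e)).isometryOfOrthonormal (v := v.toBasis)
    (by simp) ?_⟩
  have : (v.toBasis.constr ℂ (b ∘ e)) ∘ v.toBasis = b ∘ e := by
    ext i
    simp
  rw [this]
  exact hb.comp e e.injective

/-- Theorem 7.1: the best constant in the operator Hölder inequality satisfies
`𝔥_α ≥ c (1 - α)^{-1/2}`: if `K` works as a uniform operator Hölder constant for all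
functions of `Λ_α(ℝ)`-seminorm at most one and all bounded self-adjoint operators on a
separable infinite-dimensional complex Hilbert space, then `K ≥ c (1 - α)^{-1/2}`. -/
theorem stmt_19 :
    ∃ c > (0 : ℝ), ∀ α : ℝ, 0 < α → α < 1 → ∀ K : ℝ, 0 ≤ K →
      (∀ (H : Type) [NormedAddCommGroup H] [InnerProductSpace ℂ H] [CompleteSpace H]
        [TopologicalSpace.SeparableSpace H], ¬ FiniteDimensional ℂ H →
        ∀ f : ℝ → ℝ, (∀ x y : ℝ, |f x - f y| ≤ |x - y| ^ α) →
        ∀ A B : H →L[ℂ] H, IsSelfAdjoint A → IsSelfAdjoint B → A ≠ B →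
        ‖cfc f A - cfc f B‖ ≤ K * ‖A - B‖ ^ α) →
      c * (1 - α) ^ (-(1 : ℝ) / 2) ≤ K := by
  refine ⟨1 / 1152, by norm_num, fun α hα hα' K hK h => ?_⟩
  have : Fact ((2 : ENNReal) ≠ ⊤) := ⟨by simp⟩
  have hb := (fourierBasis (T := 1)).orthonormal
  have hfin : ¬ FiniteDimensional ℂ
      (MeasureTheory.Lp ℂ 2 (AddCircle.haarAddCircle (T := 1))) := by
    intro hfd
    have : Finite ℤ := hb.linearIndependent.finite
    exact not_finite ℤ
  set n := ⌈1 / (1 - α)⌉₊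
  obtain ⟨ι, _, _, ⟨D⟩⟩ := OscillatingSystem.exists_nonempty n
  obtain ⟨V⟩ := exists_linearIsometry_of_orthonormal hb ι
  have hmain := D.le_of_operator_holder V hα.le hα'.le hK (h _ hfin)
  have hpos : 0 < 1 - α := by linarith
  have hn : 1 / (1 - α) ≤ n := Nat.le_ceil _
  have hn' : n * (1 - α) ≤ 2 := by
    have := (Nat.ceil_lt_add_one (by positivity : 0 ≤ 1 / (1 - α))).le
    calc n * (1 - α) ≤ (1 / (1 - α) + 1) * (1 - α) := by gcongr
      _ = 1 + (1 - α) := by field_simp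
      _ ≤ 2 := by linarith
  have h16 : ((4 : ℝ) ^ n) ^ (1 - α) ≤ 16 := by
    rw [← Real.rpow_natCast, ← Real.rpow_mul (by norm_num)]
    calc (4 : ℝ) ^ (n * (1 - α)) ≤ 4 ^ (2 : ℝ) := by gcongr; norm_num
      _ = 16 := by norm_num
  have hexp : (1 - α) ^ (-(1 : ℝ) / 2) ≤ 1 / (1 - α) := by
    calc (1 - α) ^ (-(1 : ℝ) / 2) ≤ (1 - α) ^ (-1 : ℝ) :=
          Real.rpow_le_rpow_of_exponent_ge hpos (by linarith) (by norm_num)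
      _ = 1 / (1 - α) := by rw [Real.rpow_neg_one, one_div]
  have hK16 : ((4 : ℝ) ^ n) ^ (1 - α) * K ≤ 16 * K := by gcongr
  linarith
end
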